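/- arXiv:1903.12292 — 5 statements merged into one kernel-verified Lean document; each statement's English description precedes it below -/
import Mathlib

section
/- If G is a maximal outerplanar graph of order n ≥ 5, then the K_{1,2}-isolation number of G satisfies ι₁(G) ≤ n/5. -/
open SimpleGraph

/-- Inductive definition of a maximal outerplanar graph together with its
Hamiltonian cycle (given as the finite set of cycle edges), with vertex set
a finite subset of `ℕ`. The triangle is a mop; and a mop grows by adding a
new vertex `w` joined exactly to the two endpoints of a Hamiltonian edge
`s(u, v)`, the cycle being updated by replacing `s(u, v)` with
`s(u, w)` and `s(v, w)`. -/
inductive IsMopCycle : SimpleGraph ℕ → Finset ℕ → Finset (Sym2 ℕ) → Prop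
  | triangle (a b c : ℕ) (hab : a ≠ b) (hac : a ≠ c) (hbc : b ≠ c) :
      IsMopCycle (SimpleGraph.fromEdgeSet {s(a, b), s(b, c), s(a, c)})
        {a, b, c} {s(a, b), s(b, c), s(a, c)}
  | grow (G : SimpleGraph ℕ) (V : Finset ℕ) (C : Finset (Sym2 ℕ)) (u v w : ℕ)
      (hG : IsMopCycle G V C) (huv : s(u, v) ∈ C) (hw : w ∉ V) :
      IsMopCycle (SimpleGraph.fromEdgeSet (insert s(u, w) (insert s(v, w) G.edgeSet)))
        (insert w V) (insert s(u, w) (insert s(v, w) (C.erase s(u, v))))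

/-- `G` is a maximal outerplanar graph with vertex set `V`. -/
def IsMop (G : SimpleGraph ℕ) (V : Finset ℕ) : Prop := ∃ C, IsMopCycle G V C

/-- The closed neighborhood `N[S]` of a set of vertices `S` in `G`. -/
def closedNbhd (G : SimpleGraph ℕ) (S : Finset ℕ) : Set ℕ :=
  {v | v ∈ S ∨ ∃ u ∈ S, G.Adj u v}

/-- `S` is a `K_{1,2}`-isolating set of the graph `G` with vertex set `V`:
`S ⊆ V` and `G − N[S]` contains no copy of the star `K_{1,2}`. -/
def IsIsolating12 (G : SimpleGraph ℕ) (V : Finset ℕ) (S : Finset ℕ) : Prop :=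
  S ⊆ V ∧ ∀ x y z : ℕ, x ∈ V → y ∈ V → z ∈ V →
    x ∉ closedNbhd G S → y ∉ closedNbhd G S → z ∉ closedNbhd G S →
    G.Adj x y → G.Adj x z → y = z

/-- The `K_{1,2}`-isolation number `ι₁` of the graph `G` with vertex set `V`. -/
noncomputable def iota1 (G : SimpleGraph ℕ) (V : Finset ℕ) : ℕ :=
  sInf {k | ∃ S : Finset ℕ, IsIsolating12 G V S ∧ S.card = k}

/-- The degree of a vertex. -/
noncomputable def degOf (G : SimpleGraph ℕ) (v : ℕ) : ℕ := (G.neighborSet v).ncard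

/-- The number of vertices of degree 2. -/
noncomputable def numDeg2 (G : SimpleGraph ℕ) (V : Finset ℕ) : ℕ :=
  {v ∈ (V : Set ℕ) | degOf G v = 2}.ncard

namespace MopIso

/-- Labels: `D` = in the isolating set, `K` = must be covered, `U` = may be uncovered. -/
inductive Lab | D | K | U
  deriving DecidableEq

/-- Boundary states of a root vertex. -/
inductive St | D | K0 | K1 | U0 | U1
  deriving DecidableEq

def Root (E : ℕ → ℕ → Prop) (f : ℕ → Lab) (u : ℕ) : St → Prop
  | .D => f u = .D
  | .K0 => f u = .K
  | .K1 => f u = .K ∧ ∃ y, E u y ∧ f y = .D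
  | .U0 => f u = .U ∧ ∀ y, E u y → f y ≠ .U
  | .U1 => f u = .U ∧ ∀ y z, E u y → E u z → f y = .U → f z = .U → y = z

def lab : St → Lab
  | .D => .D
  | .K0 => .K
  | .K1 => .K
  | .U0 => .U
  | .U1 => .U

def Ok (E : ℕ → ℕ → Prop) (f : ℕ → Lab) (x : ℕ) : Prop :=
  Root E f x .D ∨ Root E f x .K1 ∨ Root E f x .U1

def addE (E : ℕ → ℕ → Prop) (p q : ℕ) : ℕ → ℕ → Prop :=
  fun x y => E x y ∨ (x = p ∧ y = q) ∨ (x = q ∧ y = p)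

def uni (E F : ℕ → ℕ → Prop) : ℕ → ℕ → Prop := fun x y => E x y ∨ F x y

def mrg : St → St → Option St
  | .D, .D => some .D
  | .K0, .K0 => some .K0
  | .K0, .K1 => some .K1
  | .K1, .K0 => some .K1
  | .K1, .K1 => some .K1
  | .U0, .U0 => some .U0
  | .U0, .U1 => some .U1
  | .U1, .U0 => some .U1
  | _, _ => none

def adE : St → St → Option (St × St)
  | .D, .K0 => some (.D, .K1)
  | .K0, .D => some (.K1, .D)
  | .U0, .U0 => some (.U1, .U1)
  | .U0, .U1 => none
  | .U1, .U0 => none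
  | .U1, .U1 => none
  | a, b => some (a, b)

/-- `weak a b`: state `a` implies state `b`. -/
def weak : St → St → Bool
  | .K1, .K0 => true
  | .U0, .U1 => true
  | a, b => decide (a = b)

lemma root_lab {E f u a} (h : Root E f u a) : f u = lab a := by
  cases a <;> simp [Root, lab] at h ⊢ <;> tauto

lemma root_congr {E E' : ℕ → ℕ → Prop} {f f' : ℕ → Lab} {x : ℕ} {a : St}
    (h : ∀ y, E x y ↔ E' x y) (hf : f x = f' x) (h2 : ∀ y, E x y → f y = f' y)
    (hr : Root E f x a) : Root E' f' x a := by
  cases a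
  · simpa [Root, ← hf] using hr
  · simpa [Root, ← hf] using hr
  · obtain ⟨h0, y, hy, hy2⟩ := hr
    exact ⟨hf ▸ h0, y, (h y).1 hy, (h2 y hy) ▸ hy2⟩
  · obtain ⟨h0, h1⟩ := hr
    refine ⟨hf ▸ h0, fun y hy => ?_⟩
    have hy' := (h y).2 hy
    rw [← h2 y hy']
    exact h1 y hy'
  · obtain ⟨h0, h1⟩ := hr
    refine ⟨hf ▸ h0, fun y z hy hz ey ez => ?_⟩
    have hy' := (h y).2 hy
    have hz' := (h z).2 hz
    rw [← h2 y hy'] at ey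
    rw [← h2 z hz'] at ez
    exact h1 y z hy' hz' ey ez

lemma ok_congr {E E' : ℕ → ℕ → Prop} {f f' : ℕ → Lab} {x : ℕ}
    (h : ∀ y, E x y ↔ E' x y) (hf : f x = f' x) (h2 : ∀ y, E x y → f y = f' y)
    (hr : Ok E f x) : Ok E' f' x := by
  rcases hr with hr | hr | hr
  · exact Or.inl (root_congr h hf h2 hr)
  · exact Or.inr (Or.inl (root_congr h hf h2 hr))
  · exact Or.inr (Or.inr (root_congr h hf h2 hr))

lemma root_weak {E f u a b} (h : Root E f u a) (hw : weak a b = true) : Root E f u b := by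
  cases a <;> cases b <;> simp [weak] at hw <;> first | exact h | skip
  · exact h.1
  · exact ⟨h.1, fun y z hy _ ey _ => absurd ey (h.2 y hy)⟩

lemma root_ok {E f u a} (h : Root E f u a) (ha : a ≠ .K0) : Ok E f u := by
  cases a
  · exact Or.inl h
  · exact absurd rfl ha
  · exact Or.inr (Or.inl h)
  · exact Or.inr (Or.inr (root_weak h rfl))
  · exact Or.inr (Or.inr h)

lemma root_mrg {E F : ℕ → ℕ → Prop} {f u a b c} (h1 : Root E f u a) (h2 : Root F f u b)
    (h : mrg a b = some c) : Root (uni E F) f u c := by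
  cases a <;> cases b <;> simp [mrg] at h <;> subst h <;> simp only [Root, uni] at * <;> grind

lemma root_adE {E : ℕ → ℕ → Prop} {f p q a b c d} (hpq : p ≠ q)
    (h1 : Root E f p a) (h2 : Root E f q b)
    (h : adE a b = some (c, d)) : Root (addE E p q) f p c ∧ Root (addE E p q) f q d := by
  cases a <;> cases b <;> simp [adE] at h <;> obtain ⟨rfl, rfl⟩ := h <;>
    simp only [Root, addE] at * <;> grind

/-- Polygons hanging on the root edge `uv`, the root edge itself being excluded from `E`. -/
inductive Poly : ℕ → ℕ → Finset ℕ → (ℕ → ℕ → Prop) → Set (Sym2 ℕ) → Prop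
  | leaf (u v : ℕ) (h : u ≠ v) : Poly u v ∅ (fun _ _ => False) {s(u, v)}
  | node (u v w : ℕ) (I J : Finset ℕ) (E F : ℕ → ℕ → Prop) (L M : Set (Sym2 ℕ))
      (h1 : Poly u w I E L) (h2 : Poly w v J F M) (huv : u ≠ v) (hv : v ∉ I) (hu : u ∉ J)
      (hd : Disjoint I J) :
      Poly u v (insert w (I ∪ J)) (uni (addE E u w) (addE F w v)) (L ∪ M)

lemma Poly.ne {u v I E L} (h : Poly u v I E L) : u ≠ v := by
  cases h <;> assumption

lemma Poly.notMem {u v I E L} (h : Poly u v I E L) : u ∉ I ∧ v ∉ I := by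
  induction h with
  | leaf => simp
  | node u v w I J E F L M h1 h2 huv hv hu hd ih1 ih2 =>
    have := h1.ne
    have := h2.ne
    simp
    grind

lemma Poly.supp {u v I E L} (h : Poly u v I E L) :
    ∀ x y, E x y → (x = u ∨ x = v ∨ x ∈ I) ∧ (y = u ∨ y = v ∨ y ∈ I) := by
  induction h with
  | leaf => simp
  | node u v w I J E F L M h1 h2 huv hv hu hd ih1 ih2 =>
    intro x y hxy
    simp only [Finset.mem_insert, Finset.mem_union]
    rcases hxy with (h | ⟨rfl, rfl⟩ | ⟨rfl, rfl⟩) | (h | ⟨rfl, rfl⟩ | ⟨rfl, rfl⟩)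
    · have := ih1 _ _ h
      tauto
    · tauto
    · tauto
    · have := ih2 _ _ h
      tauto
    · tauto
    · tauto

lemma Poly.leafMem {u v I E L} (h : Poly u v I E L) :
    ∀ p q, s(p, q) ∈ L → p ≠ q ∧ (p = u ∨ p = v ∨ p ∈ I) ∧ (q = u ∨ q = v ∨ q ∈ I) := by
  induction h with
  | leaf u v h =>
    intro p q hpq
    simp at hpq
    grind
  | node u v w I J E F L M h1 h2 huv hv hu hd ih1 ih2 =>
    intro p q hpq
    simp only [Finset.mem_insert, Finset.mem_union]
    rcases hpq with h | h
    · have := ih1 _ _ h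
      tauto
    · have := ih2 _ _ h
      tauto

lemma Poly.grow {u v I E L} (h : Poly u v I E L) :
    ∀ p q x, s(p, q) ∈ L → x ∉ I → x ≠ u → x ≠ v →
      ∃ E' L', Poly u v (insert x I) E' L' ∧
        (∀ y z, E' y z ↔ E y z ∨ s(y, z) = s(p, x) ∨ s(y, z) = s(q, x)) ∧
        (∀ e, e ∈ L → e ≠ s(p, q) → e ∈ L') ∧ s(p, x) ∈ L' ∧ s(q, x) ∈ L' := by
  induction h with
  | leaf u v h =>
    intro p q x hpq hx hxu hxv
    have hP := Poly.node u v x ∅ ∅ _ _ _ _ (Poly.leaf u x (Ne.symm hxu)) (Poly.leaf x v hxv) h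
      (by simp) (by simp) (by simp)
    simp only [Finset.union_self] at hP
    refine ⟨_, _, hP, ?_, ?_, ?_, ?_⟩
    · intro y z
      simp [uni, addE] at *
      grind
    · intro e he hne
      simp at he hpq
      grind
    · simp at hpq ⊢
      grind
    · simp at hpq ⊢
      grind
  | node u v w I J E F L M h1 h2 huv hv hu hd ih1 ih2 =>
    intro p q x hpq hx hxu hxv
    simp only [Finset.mem_insert, Finset.mem_union, not_or] at hx
    obtain ⟨hxw, hxI, hxJ⟩ := hx
    rcases hpq with hpq | hpq
    · obtain ⟨E', L', hP, hE, hL, hp, hq⟩ := ih1 p q x hpq hxI hxu hxw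
      have hN := Poly.node u v w _ J _ F _ M hP h2 huv (by simp; grind) hu
        (by rw [Finset.disjoint_insert_left]; exact ⟨hxJ, hd⟩)
      have e : insert w (insert x I ∪ J) = insert x (insert w (I ∪ J)) := by
        clear ih1 ih2 hN hP hE hL h1 h2
        ext; simp only [Finset.mem_insert, Finset.mem_union]; grind
      rw [e] at hN
      refine ⟨_, _, hN, ?_, ?_, Or.inl hp, Or.inl hq⟩
      · intro y z
        simp only [uni, addE, hE]
        generalize (s(y, z) = s(p, x)) = A1
        generalize (s(y, z) = s(q, x)) = A2
        clear hN hP hE hL ih1 ih2 hp hq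
        grind
      · intro e he hne
        rcases he with he | he
        · exact Or.inl (hL e he hne)
        · exact Or.inr he
    · obtain ⟨E', L', hP, hE, hL, hp, hq⟩ := ih2 p q x hpq hxJ hxw hxv
      have hN := Poly.node u v w I _ E _ L _ h1 hP huv hv (by simp; grind)
        (by rw [Finset.disjoint_insert_right]; exact ⟨hxI, hd⟩)
      have e : insert w (I ∪ insert x J) = insert x (insert w (I ∪ J)) := by
        clear ih1 ih2 hN hP hE hL h1 h2
        ext; simp only [Finset.mem_insert, Finset.mem_union]; grind
      rw [e] at hN
      refine ⟨_, _, hN, ?_, ?_, Or.inr hp, Or.inr hq⟩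
      · intro y z
        simp only [uni, addE, hE]
        generalize (s(y, z) = s(p, x)) = A1
        generalize (s(y, z) = s(q, x)) = A2
        clear hN hP hE hL ih1 ih2 hp hq
        grind
      · intro e he hne
        rcases he with he | he
        · exact Or.inl he
        · exact Or.inr (hL e he hne)

/-- Two polygons glued along a common root edge. -/
lemma decompose {G : SimpleGraph ℕ} {V : Finset ℕ} {C : Finset (Sym2 ℕ)} (h : IsMopCycle G V C) :
    ∃ u v I J E F L M, Poly u v I E L ∧ Poly u v J F M ∧ Disjoint I J ∧
      V = insert u (insert v (I ∪ J)) ∧ (∀ e ∈ C, e ∈ L ∨ e ∈ M) ∧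
      ∀ x y, G.Adj x y ↔ addE (uni E F) u v x y := by
  induction h with
  | triangle a b c hab hac hbc =>
    refine ⟨a, b, _, ∅, _, _, _, _, Poly.node a b c ∅ ∅ _ _ _ _ (Poly.leaf a c hac)
      (Poly.leaf c b hbc.symm) hab (by simp) (by simp) (by simp), Poly.leaf a b hab, by simp, ?_,
      ?_, ?_⟩
    · ext; simp
    · intro e he
      simp at he ⊢
      rcases he with rfl | rfl | rfl
      · simp
      · simp [Sym2.eq_swap]
      · simp
    · intro x y
      simp [SimpleGraph.fromEdgeSet_adj, addE, uni]
      grind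
  | grow G V C p q w hG hpq hw ih =>
    obtain ⟨u, v, I, J, E, F, L, M, h1, h2, hd, hV, hC, hA⟩ := ih
    subst hV
    simp only [Finset.mem_insert, Finset.mem_union, not_or] at hw
    obtain ⟨hwu, hwv, hwI, hwJ⟩ := hw
    have hne : p ≠ w ∧ q ≠ w := by
      rcases hC _ hpq with h | h
      · have := h1.leafMem p q h
        grind
      · have := h2.leafMem p q h
        grind
    have key : ∀ x y, (SimpleGraph.fromEdgeSet
        (insert s(p, w) (insert s(q, w) G.edgeSet))).Adj x y ↔
        (addE (uni E F) u v x y ∨ s(x, y) = s(p, w) ∨ s(x, y) = s(q, w)) := by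
      intro x y
      rw [← hA, SimpleGraph.fromEdgeSet_adj]
      simp only [Set.mem_insert_iff, SimpleGraph.mem_edgeSet]
      constructor
      · tauto
      · intro h
        refine ⟨by tauto, ?_⟩
        rcases h with h | h | h
        · exact h.ne
        · simp at h
          grind
        · simp at h
          grind
    rcases hC _ hpq with h | h
    · obtain ⟨E', L', hP, hE, hL, hp, hq⟩ := h1.grow p q w h hwI hwu hwv
      refine ⟨u, v, _, J, E', F, L', M, hP, h2, ?_, ?_, ?_, ?_⟩
      · rw [Finset.disjoint_insert_left]; exact ⟨hwJ, hd⟩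
      · ext; simp; tauto
      · intro e he
        simp only [Finset.mem_insert, Finset.mem_erase] at he
        rcases he with rfl | rfl | ⟨h3, h4⟩
        · exact Or.inl hp
        · exact Or.inl hq
        · rcases hC e h4 with h5 | h5
          · exact Or.inl (hL e h5 h3)
          · exact Or.inr h5
      · intro x y
        rw [key]
        simp only [addE, uni, hE]
        tauto
    · obtain ⟨E', L', hP, hE, hL, hp, hq⟩ := h2.grow p q w h hwJ hwu hwv
      refine ⟨u, v, I, _, E, E', L, L', h1, hP, ?_, ?_, ?_, ?_⟩
      · rw [Finset.disjoint_insert_right]; exact ⟨hwI, hd⟩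
      · ext; simp; tauto
      · intro e he
        simp only [Finset.mem_insert, Finset.mem_erase] at he
        rcases he with rfl | rfl | ⟨h3, h4⟩
        · exact Or.inr hp
        · exact Or.inr hq
        · rcases hC e h4 with h5 | h5
          · exact Or.inl h5
          · exact Or.inr (hL e h5 h3)
      · intro x y
        rw [key]
        simp only [addE, uni, hE]
        tauto

/-- Some labelling realises the root states with at most `k` interior vertices labelled `D`. -/
def Sem (u v : ℕ) (I : Finset ℕ) (E : ℕ → ℕ → Prop) (a b : St) (k : ℕ) : Prop :=
  ∃ f : ℕ → Lab, Root E f u a ∧ Root E f v b ∧ (∀ x ∈ I, Ok E f x) ∧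
    (I.filter (fun x => f x = .D)).card ≤ k

lemma Sem.weaken {u v I E a b a' b' k} (h : Sem u v I E a b k) (h1 : weak a a' = true)
    (h2 : weak b b' = true) : Sem u v I E a' b' k := by
  obtain ⟨f, hu, hv, hI, hk⟩ := h
  exact ⟨f, root_weak hu h1, root_weak hv h2, hI, hk⟩

lemma Sem.edge {u v I E a b c d k} (h : Sem u v I E a b k) (huv : u ≠ v) (hu : u ∉ I) (hv : v ∉ I)
    (hc : adE a b = some (c, d)) : Sem u v I (addE E u v) c d k := by
  obtain ⟨f, h1, h2, hI, hk⟩ := h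
  obtain ⟨h3, h4⟩ := root_adE huv h1 h2 hc
  refine ⟨f, h3, h4, fun x hx => ?_, hk⟩
  refine ok_congr ?_ rfl (fun _ _ => rfl) (hI x hx)
  intro y
  have : x ≠ u := by rintro rfl; exact hu hx
  have : x ≠ v := by rintro rfl; exact hv hx
  simp [addE]
  tauto

lemma mrg_lab {a b c} (h : mrg a b = some c) : lab a = lab c ∧ lab b = lab c := by
  cases a <;> cases b <;> simp [mrg] at h <;> subst h <;> simp [lab]

lemma Sem.join {u v w I J E F a x y b c k l} (h1 : Sem u w I E a x k) (h2 : Sem w v J F y b l)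
    (hE : ∀ s t, E s t → (s = u ∨ s = w ∨ s ∈ I) ∧ (t = u ∨ t = w ∨ t ∈ I))
    (hF : ∀ s t, F s t → (s = w ∨ s = v ∨ s ∈ J) ∧ (t = w ∨ t = v ∨ t ∈ J))
    (huw : u ≠ w) (hwv : w ≠ v) (huv : u ≠ v) (huI : u ∉ I) (hwI : w ∉ I) (hvI : v ∉ I)
    (huJ : u ∉ J) (hwJ : w ∉ J) (hvJ : v ∉ J) (hd : Disjoint I J)
    (hc : mrg x y = some c) (hc0 : c ≠ .K0) :
    Sem u v (insert w (I ∪ J)) (uni E F) a b (k + l + if c = .D then 1 else 0) := by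
  obtain ⟨f, hu, hw, hI, hk⟩ := h1
  obtain ⟨g, hw', hv, hJ, hl⟩ := h2
  have hfg : f w = g w := by
    rw [root_lab hw, root_lab hw', (mrg_lab hc).1, (mrg_lab hc).2]
  have hdis : ∀ s, s ∈ I → s ∉ J := fun s h1 h2 => Finset.disjoint_left.1 hd h1 h2
  let r : ℕ → Lab := fun s => if s ∈ I ∨ s = u ∨ s = w then f s else g s
  have r1 : ∀ s, (s = u ∨ s = w ∨ s ∈ I) → f s = r s := by
    intro s hs
    have : s ∈ I ∨ s = u ∨ s = w := by tauto
    simp [r, this]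
  have r2 : ∀ s, (s = w ∨ s = v ∨ s ∈ J) → g s = r s := by
    intro s hs
    by_cases hsw : s = w
    · subst hsw
      simp [r, hfg]
    · have : ¬ (s ∈ I ∨ s = u ∨ s = w) := by grind
      simp [r, this]
  have e1 : ∀ s, s = u ∨ s ∈ I → ∀ t, E s t ↔ uni E F s t := by
    intro s hs t
    refine ⟨Or.inl, ?_⟩
    rintro (h | h)
    · exact h
    · have := hF s t h
      grind
  have e2 : ∀ s, s = v ∨ s ∈ J → ∀ t, F s t ↔ uni E F s t := by
    intro s hs t
    refine ⟨Or.inr, ?_⟩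
    rintro (h | h)
    · have := hE s t h
      grind
    · exact h
  have hwr : Root (uni E F) r w c := by
    refine root_mrg ?_ ?_ hc
    · exact root_congr (fun _ => Iff.rfl) (r1 w (by simp)) (fun t ht => r1 t (hE w t ht).2) hw
    · exact root_congr (fun _ => Iff.rfl) (r2 w (by simp)) (fun t ht => r2 t (hF w t ht).2) hw'
  refine ⟨r, ?_, ?_, ?_, ?_⟩
  · exact root_congr (e1 u (by simp)) (r1 u (by simp)) (fun t ht => r1 t (hE u t ht).2) hu
  · exact root_congr (e2 v (by simp)) (r2 v (by simp)) (fun t ht => r2 t (hF v t ht).2) hv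
  · intro s hs
    simp only [Finset.mem_insert, Finset.mem_union] at hs
    rcases hs with rfl | hs | hs
    · exact root_ok hwr hc0
    · exact ok_congr (e1 s (by simp [hs])) (r1 s (by simp [hs])) (fun t ht => r1 t (hE s t ht).2)
        (hI s hs)
    · exact ok_congr (e2 s (by simp [hs])) (r2 s (by simp [hs])) (fun t ht => r2 t (hF s t ht).2)
        (hJ s hs)
  · have hrw := root_lab hwr
    have q1 : I.filter (fun s => r s = .D) = I.filter (fun s => f s = .D) :=
      Finset.filter_congr (fun s hs => by rw [r1 s (by simp [hs])])
    have q2 : J.filter (fun s => r s = .D) = J.filter (fun s => g s = .D) :=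
      Finset.filter_congr (fun s hs => by rw [r2 s (by simp [hs])])
    rw [Finset.filter_insert, Finset.filter_union, q1, q2]
    have hle := Finset.card_union_le (I.filter (fun s => f s = .D)) (J.filter (fun s => g s = .D))
    by_cases hcD : c = .D
    · subst hcD
      simp only [hrw, lab, if_true]
      have := Finset.card_insert_le w
        (I.filter (fun s => f s = .D) ∪ J.filter (fun s => g s = .D))
      omega
    · have : r w ≠ .D := by
        rw [hrw]
        cases c <;> simp_all [lab]
      simp only [this, hcD, if_false]
      omega

lemma Sem.final {u v I J E F a b a' b' c d c' d' k l} (h1 : Sem u v I E a b k)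
    (h2 : Sem u v J F a' b' l)
    (hE : ∀ s t, E s t → (s = u ∨ s = v ∨ s ∈ I) ∧ (t = u ∨ t = v ∨ t ∈ I))
    (hF : ∀ s t, F s t → (s = u ∨ s = v ∨ s ∈ J) ∧ (t = u ∨ t = v ∨ t ∈ J))
    (huv : u ≠ v) (huI : u ∉ I) (hvI : v ∉ I)
    (huJ : u ∉ J) (hvJ : v ∉ J) (hd : Disjoint I J)
    (hc : mrg a a' = some c) (hc' : mrg b b' = some d) (hcd : adE c d = some (c', d'))
    (h0 : c' ≠ .K0) (h0' : d' ≠ .K0) :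
    ∃ f : ℕ → Lab, (∀ x ∈ insert u (insert v (I ∪ J)), Ok (addE (uni E F) u v) f x) ∧
      ((insert u (insert v (I ∪ J))).filter (fun x => f x = .D)).card ≤
        k + l + (if c' = .D then 1 else 0) + (if d' = .D then 1 else 0) := by
  obtain ⟨f, hu, hv, hI, hk⟩ := h1
  obtain ⟨g, hu', hv', hJ, hl⟩ := h2
  have hfg : f u = g u := by
    rw [root_lab hu, root_lab hu', (mrg_lab hc).1, (mrg_lab hc).2]
  have hfg' : f v = g v := by
    rw [root_lab hv, root_lab hv', (mrg_lab hc').1, (mrg_lab hc').2]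
  have hdis : ∀ s, s ∈ I → s ∉ J := fun s h1 h2 => Finset.disjoint_left.1 hd h1 h2
  let r : ℕ → Lab := fun s => if s ∈ I then f s else g s
  have r1 : ∀ s, (s = u ∨ s = v ∨ s ∈ I) → f s = r s := by
    intro s hs
    rcases hs with rfl | rfl | hs
    · simp [r, huI, hfg]
    · simp [r, hvI, hfg']
    · simp [r, hs]
  have r2 : ∀ s, (s = u ∨ s = v ∨ s ∈ J) → g s = r s := by
    intro s hs
    have : s ∉ I := by grind
    simp [r, this]
  have e1 : ∀ s, s ∈ I → ∀ t, E s t ↔ addE (uni E F) u v s t := by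
    intro s hs t
    refine ⟨fun h => Or.inl (Or.inl h), ?_⟩
    rintro ((h | h) | h)
    · exact h
    · have := hF s t h
      grind
    · grind
  have e2 : ∀ s, s ∈ J → ∀ t, F s t ↔ addE (uni E F) u v s t := by
    intro s hs t
    refine ⟨fun h => Or.inl (Or.inr h), ?_⟩
    rintro ((h | h) | h)
    · have := hE s t h
      grind
    · exact h
    · grind
  have hur : Root (uni E F) r u c := by
    refine root_mrg ?_ ?_ hc
    · exact root_congr (fun _ => Iff.rfl) (r1 u (by simp)) (fun t ht => r1 t (hE u t ht).2) hu
    · exact root_congr (fun _ => Iff.rfl) (r2 u (by simp)) (fun t ht => r2 t (hF u t ht).2) hu'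
  have hvr : Root (uni E F) r v d := by
    refine root_mrg ?_ ?_ hc'
    · exact root_congr (fun _ => Iff.rfl) (r1 v (by simp)) (fun t ht => r1 t (hE v t ht).2) hv
    · exact root_congr (fun _ => Iff.rfl) (r2 v (by simp)) (fun t ht => r2 t (hF v t ht).2) hv'
  obtain ⟨hur', hvr'⟩ := root_adE huv hur hvr hcd
  refine ⟨r, ?_, ?_⟩
  · intro s hs
    simp only [Finset.mem_insert, Finset.mem_union] at hs
    rcases hs with rfl | rfl | hs | hs
    · exact root_ok hur' h0
    · exact root_ok hvr' h0'
    · exact ok_congr (e1 s hs) (r1 s (by simp [hs])) (fun t ht => r1 t (hE s t ht).2)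
        (hI s hs)
    · exact ok_congr (e2 s hs) (r2 s (by simp [hs])) (fun t ht => r2 t (hF s t ht).2)
        (hJ s hs)
  · have hru := root_lab hur'
    have hrv := root_lab hvr'
    have q1 : I.filter (fun s => r s = .D) = I.filter (fun s => f s = .D) :=
      Finset.filter_congr (fun s hs => by rw [r1 s (by simp [hs])])
    have q2 : J.filter (fun s => r s = .D) = J.filter (fun s => g s = .D) :=
      Finset.filter_congr (fun s hs => by rw [r2 s (by simp [hs])])
    have hle := Finset.card_union_le (I.filter (fun s => f s = .D)) (J.filter (fun s => g s = .D))
    have step : ∀ (A : Finset ℕ) (p : ℕ) (z : St), r p = lab z →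
        ((insert p A).filter (fun s => r s = .D)).card ≤
          (A.filter (fun s => r s = .D)).card + if z = .D then 1 else 0 := by
      intro A p z hz
      rw [Finset.filter_insert]
      by_cases hcD : z = .D
      · subst hcD
        simp only [hz, lab, if_true]
        exact Finset.card_insert_le _ _
      · have : r p ≠ .D := by
          rw [hz]
          cases z <;> simp_all [lab]
        simp [this, hcD]
    have s1 := step (insert v (I ∪ J)) u c' hru
    have s2 := step (I ∪ J) v d' hrv
    have s3 : ((I ∪ J).filter (fun s => r s = .D)).card ≤ k + l := by
      rw [Finset.filter_union, q1, q2]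
      omega
    omega

/-! ### The finite family of profiles

`famL` lists, for each size class, profiles (vectors of upper bounds, shifted by one, `9` standing
for no bound) indexed by the pairs of root states in `keepL`. -/

def keepL : List (St × St) := [(.D, .D), (.D, .K0), (.K0, .D), (.K0, .K0), (.K0, .K1), (.K0, .U0), (.K0, .U1), (.K1, .K0), (.K1, .K1), (.K1, .U0), (.K1, .U1), (.U0, .K0), (.U0, .K1), (.U0, .U0), (.U1, .K0), (.U1, .K1)]

def transL : List (List (ℕ × ℕ × ℕ)) := [
  [(0, 0, 1), (1, 2, 0)],
  [(0, 1, 1), (1, 3, 0)],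
  [(2, 0, 1), (3, 2, 0)],
  [(2, 1, 1), (3, 7, 0), (4, 3, 0), (5, 14, 0), (6, 11, 0)],
  [(2, 1, 1), (3, 8, 0), (4, 4, 0), (5, 15, 0), (6, 12, 0)],
  [(3, 9, 0), (4, 5, 0)],
  [(3, 10, 0), (4, 6, 0), (5, 13, 0)],
  [(2, 1, 1), (7, 7, 0), (8, 3, 0), (9, 14, 0), (10, 11, 0)],
  [(2, 1, 1), (7, 8, 0), (8, 4, 0), (9, 15, 0), (10, 12, 0)],
  [(7, 9, 0), (8, 5, 0)],
  [(7, 10, 0), (8, 6, 0), (9, 13, 0)],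
  [(11, 7, 0), (12, 3, 0)],
  [(11, 8, 0), (12, 4, 0)],
  [(11, 9, 0), (12, 5, 0)],
  [(13, 11, 0), (14, 7, 0), (15, 3, 0)],
  [(13, 12, 0), (14, 8, 0), (15, 4, 0)]]

def finL : List (ℕ × ℕ × ℕ) := [(0, 0, 2), (1, 1, 1), (2, 2, 1), (3, 8, 0), (4, 7, 0), (4, 8, 0), (5, 9, 0), (5, 10, 0), (6, 9, 0), (7, 4, 0), (7, 8, 0), (8, 3, 0), (8, 4, 0), (8, 7, 0), (8, 8, 0), (9, 5, 0), (9, 6, 0), (9, 9, 0), (9, 10, 0), (10, 5, 0), (10, 9, 0), (11, 12, 0), (11, 15, 0), (12, 11, 0), (12, 12, 0), (12, 14, 0), (12, 15, 0), (13, 13, 0), (14, 12, 0), (15, 11, 0), (15, 12, 0)]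

def famL : List (List (List ℕ)) := [
  [[1, 1, 1, 1, 9, 1, 1, 9, 9, 9, 9, 1, 9, 1, 1, 9]],
  [[1, 1, 1, 1, 2, 9, 1, 2, 2, 9, 9, 9, 9, 9, 1, 9]],
  [[1, 1, 1, 1, 2, 9, 9, 2, 2, 9, 9, 9, 9, 9, 9, 9]],
  [[1, 1, 1, 2, 2, 9, 9, 2, 2, 9, 9, 9, 9, 9, 9, 9]],
  [[1, 2, 1, 2, 2, 9, 9, 2, 2, 9, 9, 9, 9, 9, 9, 9],
   [1, 1, 2, 2, 2, 2, 2, 2, 2, 2, 2, 9, 9, 9, 9, 9]],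
  [[0, 1, 0, 1, 1, 9, 9, 2, 2, 9, 9, 1, 1, 9, 1, 1],
   [1, 1, 1, 1, 1, 9, 9, 1, 1, 9, 9, 9, 9, 9, 9, 9],
   [0, 0, 1, 1, 2, 1, 1, 1, 2, 1, 1, 9, 9, 9, 9, 9]],
  [[1, 1, 1, 1, 1, 9, 9, 1, 1, 9, 9, 9, 9, 9, 9, 9],
   [1, 1, 1, 1, 1, 9, 9, 2, 2, 9, 9, 1, 1, 9, 1, 1],
   [1, 1, 1, 1, 2, 1, 1, 1, 2, 1, 1, 9, 9, 9, 9, 9],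
   [0, 1, 0, 1, 1, 9, 9, 2, 2, 9, 9, 9, 9, 9, 1, 1],
   [0, 0, 1, 1, 2, 9, 1, 1, 2, 9, 1, 9, 9, 9, 9, 9]],
  [[1, 1, 1, 1, 2, 1, 1, 2, 2, 9, 9, 1, 9, 1, 1, 9],
   [1, 1, 1, 1, 1, 9, 9, 2, 2, 9, 9, 9, 9, 9, 1, 1],
   [1, 1, 1, 1, 2, 9, 1, 1, 2, 9, 1, 9, 9, 9, 9, 9],
   [0, 1, 0, 1, 1, 9, 9, 2, 2, 9, 9, 9, 9, 9, 9, 9],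
   [1, 1, 1, 1, 1, 9, 9, 1, 1, 9, 9, 9, 9, 9, 9, 9],
   [0, 0, 1, 1, 2, 9, 9, 1, 2, 9, 9, 9, 9, 9, 9, 9]],
  [[1, 1, 1, 2, 2, 9, 9, 2, 2, 9, 9, 9, 9, 9, 9, 9]],
  [[1, 1, 2, 2, 2, 9, 9, 2, 2, 9, 9, 9, 9, 9, 9, 9],
   [1, 2, 1, 2, 2, 9, 9, 2, 2, 9, 9, 9, 9, 9, 9, 9]]]


def keep (i : ℕ) : St × St := keepL.getD i (.D, .D)

def okTrans (l r t : St × St) (c : ℕ) : Bool :=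
  match adE l.1 l.2, adE r.1 r.2 with
  | some (a, x), some (y, b) =>
    match mrg x y with
    | some w => decide (w ≠ .K0) && decide ((if w = .D then 1 else 0) ≤ c) && weak a t.1 &&
        weak b t.2
    | none => false
  | _, _ => false

def okFin (l r : St × St) (c : ℕ) : Bool :=
  match mrg l.1 r.1, mrg l.2 r.2 with
  | some x, some y =>
    match adE x y with
    | some (x', y') => decide (x' ≠ .K0) && decide (y' ≠ .K0) &&
        decide ((if x' = .D then 1 else 0) + (if y' = .D then 1 else 0) ≤ c)
    | none => false
  | _, _ => false

def nkey (i j : ℕ) : ℕ := if i + j + 1 < 5 then i + j + 1 else 5 + (i + j + 1) % 5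

def key (m : ℕ) : ℕ := if m < 5 then m else 5 + m % 5

def fam (k : ℕ) : List (List ℕ) := famL.getD k []

def chkR (P Q R : List ℕ) (cy : ℕ) : Bool :=
  (List.range 16).all fun i => Nat.beq (R.getD i 9) 9 ||
    (transL.getD i []).any fun t =>
      Nat.ble (P.getD t.1 9 + Q.getD t.2.1 9 + t.2.2) (R.getD i 9 + cy + 1)
        && Nat.blt (P.getD t.1 9) 9 && Nat.blt (Q.getD t.2.1 9) 9

def chkNode : Bool :=
  (List.range 10).all fun i => (List.range 10).all fun j =>
    (fam i).all fun P => (fam j).all fun Q =>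
      (fam (nkey i j)).any fun R => chkR P Q R ((i % 5 + j % 5 + 1) / 5)

def chkFin : Bool :=
  (List.range 10).all fun i => (List.range 10).all fun j => Nat.blt (i + j) 3 ||
    (fam i).all fun P => (fam j).all fun Q =>
      finL.any fun t =>
        Nat.ble (P.getD t.1 9 + Q.getD t.2.1 9 + t.2.2) (2 + (i % 5 + j % 5 + 2) / 5)
          && Nat.blt (P.getD t.1 9) 9 && Nat.blt (Q.getD t.2.1 9) 9

def chkTrans : Bool :=
  (List.range 16).all fun i => (transL.getD i []).all fun t =>
    Nat.blt t.1 16 && Nat.blt t.2.1 16 && okTrans (keep t.1) (keep t.2.1) (keep i) t.2.2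

def chkFinL : Bool :=
  finL.all fun t =>
    Nat.blt t.1 16 && Nat.blt t.2.1 16 && okFin (keep t.1) (keep t.2.1) t.2.2

lemma chkNode_true : chkNode = true := by decide +kernel

lemma chkFin_true : chkFin = true := by decide +kernel

lemma chkTrans_true : chkTrans = true := by decide +kernel

lemma chkFinL_true : chkFinL = true := by decide +kernel

/-- The profile `P` bounds the polygon. -/
def Bd (u v : ℕ) (I : Finset ℕ) (E : ℕ → ℕ → Prop) (P : List ℕ) : Prop :=
  ∀ i < 16, P.getD i 9 < 9 →
    ∃ k, Sem u v I E (keep i).1 (keep i).2 k ∧ k + 1 ≤ P.getD i 9 + I.card / 5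

lemma key_lt (m : ℕ) : key m < 10 := by
  unfold key
  split <;> omega

lemma nkey_key (m n : ℕ) : nkey (key m) (key n) = key (m + n + 1) := by
  unfold nkey key
  split_ifs <;> omega

lemma key_mod (m : ℕ) : key m % 5 = m % 5 := by
  unfold key
  split <;> omega

lemma Sem.trans {u v w I J E F k l L M} {p q t : St × St} {c : ℕ}
    (hp : Poly u w I E L) (hq : Poly w v J F M) (huv : u ≠ v) (hvI : v ∉ I) (huJ : u ∉ J)
    (hd : Disjoint I J)
    (h1 : Sem u w I E p.1 p.2 k) (h2 : Sem w v J F q.1 q.2 l) (h : okTrans p q t c = true) :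
    ∃ n, n ≤ k + l + c ∧
      Sem u v (insert w (I ∪ J)) (uni (addE E u w) (addE F w v)) t.1 t.2 n := by
  unfold okTrans at h
  split at h
  · rename_i a x y b e1 e2
    split at h
    · rename_i z e3
      simp only [Bool.and_eq_true, decide_eq_true_eq] at h
      obtain ⟨⟨⟨hz, hc⟩, ha⟩, hb⟩ := h
      have g1 := h1.edge hp.ne hp.notMem.1 hp.notMem.2 e1
      have g2 := h2.edge hq.ne hq.notMem.1 hq.notMem.2 e2
      have s1 := hp.supp
      have s2 := hq.supp
      have g3 := g1.join g2 (by
          rintro s t (h | ⟨rfl, rfl⟩ | ⟨rfl, rfl⟩)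
          · exact s1 s t h
          · simp
          · simp) (by
          rintro s t (h | ⟨rfl, rfl⟩ | ⟨rfl, rfl⟩)
          · exact s2 s t h
          · simp
          · simp) hp.ne hq.ne huv hp.notMem.1 hp.notMem.2 hvI huJ hq.notMem.1 hq.notMem.2 hd e3 hz
      exact ⟨_, by omega, g3.weaken ha hb⟩
    · simp at h
  · simp at h

lemma Poly.bound {u v I E L} (h : Poly u v I E L) : ∃ P ∈ fam (key I.card), Bd u v I E P := by
  induction h with
  | leaf u v h =>
    refine ⟨[1, 1, 1, 1, 9, 1, 1, 9, 9, 9, 9, 1, 9, 1, 1, 9], by simp [key, fam, famL], ?_⟩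
    intro i hi hP
    refine ⟨0, ?_, ?_⟩
    · have hle : ∀ a b : St, a ≠ .K1 → b ≠ .K1 → Sem u v ∅ (fun _ _ => False) a b 0 := by
        intro a b ha hb
        refine ⟨fun x => if x = u then lab a else lab b, ?_, ?_, by simp, by simp⟩
        · cases a <;> simp [Root, lab] at ha ⊢
        · cases b <;> simp [Root, lab, h.symm] at hb ⊢
      interval_cases i <;> simp at hP <;> exact hle _ _ (by decide) (by decide)
    · interval_cases i <;> simp at hP ⊢
  | node u v w I J E F L M h1 h2 huv hv hu hd ih1 ih2 =>
    obtain ⟨P, hP, bP⟩ := ih1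
    obtain ⟨Q, hQ, bQ⟩ := ih2
    have hcard : (insert w (I ∪ J)).card = I.card + J.card + 1 := by
      rw [Finset.card_insert_of_notMem, Finset.card_union_of_disjoint hd]
      simp [h1.notMem.2, h2.notMem.1]
    have hn := chkNode_true
    unfold chkNode at hn
    simp only [List.all_eq_true, List.any_eq_true, List.mem_range] at hn
    obtain ⟨R, hR, hchk⟩ := hn _ (key_lt I.card) _ (key_lt J.card) P hP Q hQ
    rw [nkey_key, ← hcard] at hR
    refine ⟨R, hR, ?_⟩
    intro i hi hRi
    unfold chkR at hchk
    simp only [List.all_eq_true, List.any_eq_true, List.mem_range, Bool.or_eq_true,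
      Bool.and_eq_true, Nat.beq_eq, Nat.ble_eq, Nat.blt_eq, key_mod] at hchk
    rcases hchk i hi with h9 | ⟨t, ht, ⟨hle, hPt⟩, hQt⟩
    · omega
    · have hT := chkTrans_true
      unfold chkTrans at hT
      simp only [List.all_eq_true, List.mem_range, Bool.and_eq_true, Nat.blt_eq] at hT
      obtain ⟨⟨t1, t2⟩, t3⟩ := hT i hi t ht
      obtain ⟨k, hk, hk'⟩ := bP t.1 t1 hPt
      obtain ⟨l, hl, hl'⟩ := bQ t.2.1 t2 hQt
      obtain ⟨n, hn, hs⟩ := Sem.trans h1 h2 huv hv hu hd hk hl t3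
      refine ⟨n, hs, ?_⟩
      rw [hcard]
      omega

lemma exists_label {G : SimpleGraph ℕ} {V : Finset ℕ} {C : Finset (Sym2 ℕ)}
    (h : IsMopCycle G V C) (hn : 5 ≤ V.card) :
    ∃ f : ℕ → Lab, (∀ x ∈ V, Ok G.Adj f x) ∧
      (V.filter (fun x => f x = .D)).card ≤ V.card / 5 := by
  obtain ⟨u, v, I, J, E, F, L, M, h1, h2, hd, rfl, -, hA⟩ := decompose h
  have hA' : G.Adj = addE (uni E F) u v := by
    funext x y
    exact propext (hA x y)
  have hcard : (insert u (insert v (I ∪ J))).card = I.card + J.card + 2 := by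
    rw [Finset.card_insert_of_notMem, Finset.card_insert_of_notMem,
      Finset.card_union_of_disjoint hd]
    · simp [h1.notMem.2, h2.notMem.2]
    · simp [h1.notMem.1, h2.notMem.1, h1.ne]
  rw [hcard] at hn ⊢
  rw [hA']
  obtain ⟨P, hP, bP⟩ := h1.bound
  obtain ⟨Q, hQ, bQ⟩ := h2.bound
  have hf := chkFin_true
  unfold chkFin at hf
  simp only [List.all_eq_true, List.any_eq_true, List.mem_range, Bool.or_eq_true,
      Bool.and_eq_true, Nat.ble_eq, Nat.blt_eq] at hf
  rcases hf _ (key_lt I.card) _ (key_lt J.card) with h3 | h3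
  · unfold key at h3
    split_ifs at h3 <;> omega
  obtain ⟨t, ht, ⟨hle, hPt⟩, hQt⟩ := h3 P hP Q hQ
  rw [key_mod, key_mod] at hle
  have hT := chkFinL_true
  unfold chkFinL at hT
  simp only [List.all_eq_true, Bool.and_eq_true, Nat.blt_eq] at hT
  obtain ⟨⟨t1, t2⟩, t3⟩ := hT t ht
  obtain ⟨k, hk, hk'⟩ := bP t.1 t1 hPt
  obtain ⟨l, hl, hl'⟩ := bQ t.2.1 t2 hQt
  unfold okFin at t3
  split at t3
  · rename_i x y e1 e2
    split at t3
    · rename_i x' y' e3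
      simp only [Bool.and_eq_true, decide_eq_true_eq] at t3
      obtain ⟨⟨hx, hy⟩, hc⟩ := t3
      obtain ⟨f, hf1, hf2⟩ := hk.final hl h1.supp h2.supp h1.ne h1.notMem.1 h1.notMem.2
        h2.notMem.1 h2.notMem.2 hd e1 e2 e3 hx hy
      exact ⟨f, hf1, by omega⟩
    · simp at t3
  · simp at t3

lemma iota_le {G : SimpleGraph ℕ} {V : Finset ℕ} {f : ℕ → Lab} (h : ∀ x ∈ V, Ok G.Adj f x)
    (hV : ∀ x y, G.Adj x y → y ∈ V) :
    iota1 G V ≤ (V.filter (fun x => f x = .D)).card := by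
  refine Nat.sInf_le ⟨V.filter (fun x => f x = .D), ⟨Finset.filter_subset _ _, ?_⟩, rfl⟩
  have hU : ∀ x ∈ V, x ∉ closedNbhd G (V.filter (fun x => f x = .D)) → Root G.Adj f x .U1 := by
    intro x hx hxn
    rcases h x hx with h | h | h
    · exact absurd (Or.inl (Finset.mem_filter.2 ⟨hx, h⟩)) hxn
    · obtain ⟨-, y, hy, hyD⟩ := h
      exact absurd (Or.inr ⟨y, Finset.mem_filter.2 ⟨hV x y hy, hyD⟩, hy.symm⟩) hxn
    · exact h
  intro x y z hx hy hz hxn hyn hzn hxy hxz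
  exact (hU x hx hxn).2 y z hxy hxz (hU y hy hyn).1 (hU z hz hzn).1

lemma adj_mem {G : SimpleGraph ℕ} {V : Finset ℕ} {C : Finset (Sym2 ℕ)}
    (h : IsMopCycle G V C) : ∀ x y, G.Adj x y → y ∈ V := by
  obtain ⟨u, v, I, J, E, F, L, M, h1, h2, hd, rfl, -, hA⟩ := decompose h
  intro x y hxy
  rw [hA] at hxy
  simp only [Finset.mem_insert, Finset.mem_union]
  rcases hxy with (h | h) | h | h
  · have := h1.supp x y h
    tauto
  · have := h2.supp x y h
    tauto
  · tauto
  · tauto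

end MopIso

/-- **Theorem 2 (Borg–Kaemawichanurat).** If `G` is a maximal outerplanar graph of
order `n ≥ 5`, then `ι₁(G) ≤ n / 5`. -/
theorem mop_iota1_le_card_div_five (G : SimpleGraph ℕ) (V : Finset ℕ)
    (hG : IsMop G V) (hn : 5 ≤ V.card) :
    (iota1 G V : ℚ) ≤ (V.card : ℚ) / 5 := by
  obtain ⟨C, hC⟩ := hG
  obtain ⟨f, h1, h2⟩ := MopIso.exists_label hC hn
  have h3 := (MopIso.iota_le h1 (MopIso.adj_mem hC)).trans h2
  have h4 : iota1 G V * 5 ≤ V.card := by omega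
  rw [le_div_iff₀ (by norm_num)]
  exact_mod_cast h4
end

section
/- If G is a maximal outerplanar graph of order n ≥ 5, n₂ denotes the number of vertices of G of degree 2, and n₂ ≤ n/3, then the K_{1,2}-isolation number of G satisfies ι₁(G) ≤ (n + n₂)/6. -/
open SimpleGraph

namespace MopProof

/-- Triangulated polygons sitting on a root edge. -/
inductive Tr
  | leaf : Tr
  | node (c : ℕ) (l r : Tr) : Tr

/-- Interior vertices (all but the two root vertices). -/
def In : Tr → Finset ℕ
  | .leaf => ∅
  | .node c l r => insert c (In l ∪ In r)

/-- Edges, without the root edge. -/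
def Ed : Tr → ℕ → ℕ → Finset (Sym2 ℕ)
  | .leaf, _, _ => ∅
  | .node c l r, a, b => insert s(a, c) (insert s(c, b) (Ed l a c ∪ Ed r c b))

/-- Outer edges. -/
def Ou : Tr → ℕ → ℕ → Finset (Sym2 ℕ)
  | .leaf, a, b => {s(a, b)}
  | .node c l r, a, b => Ou l a c ∪ Ou r c b

/-- Vertices of degree two. -/
def D2 : Tr → Finset ℕ
  | .leaf => ∅
  | .node c .leaf .leaf => {c}
  | .node _ l r => D2 l ∪ D2 r

/-- Well-formedness: all the vertices are distinct. -/
def WF : Tr → ℕ → ℕ → Prop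
  | .leaf, a, b => a ≠ b
  | .node c l r, a, b => a ≠ b ∧ a ≠ c ∧ c ≠ b ∧ a ∉ In l ∧ a ∉ In r ∧ b ∉ In l ∧ b ∉ In r ∧
      c ∉ In l ∧ c ∉ In r ∧ Disjoint (In l) (In r) ∧ WF l a c ∧ WF r c b

lemma WF.ne {t : Tr} {a b : ℕ} (h : WF t a b) : a ≠ b := by
  cases t with
  | leaf => exact h
  | node c l r => exact h.1

lemma WF.notMem {t : Tr} {a b : ℕ} (h : WF t a b) : a ∉ In t ∧ b ∉ In t := by
  cases t with
  | leaf => simp [In]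
  | node c l r => simp only [WF] at h; simp only [In]; grind

lemma ed_supp {t : Tr} : ∀ {a b x y : ℕ}, WF t a b → s(x, y) ∈ Ed t a b →
    (x = a ∨ x = b ∨ x ∈ In t) ∧ (y = a ∨ y = b ∨ y ∈ In t) ∧ x ≠ y ∧
    (x ∈ In t ∨ y ∈ In t) := by
  induction t with
  | leaf => intro a b x y _ h; simp [Ed] at h
  | node c l r ihl ihr =>
    intro a b x y hw h
    simp only [WF] at hw
    simp only [Ed, Finset.mem_insert, Finset.mem_union, Sym2.eq_iff] at h
    simp only [In, Finset.mem_insert, Finset.mem_union]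
    obtain ⟨h1, h2, h3, h4, h5, h6, h7, h8, h9, h10, h11, h12⟩ := hw
    rcases h with h | h | h | h
    · grind
    · grind
    · have := ihl h11 h; grind
    · have := ihr h12 h; grind

lemma ou_supp {t : Tr} : ∀ {a b x y : ℕ}, WF t a b → s(x, y) ∈ Ou t a b →
    (x = a ∨ x = b ∨ x ∈ In t) ∧ (y = a ∨ y = b ∨ y ∈ In t) ∧ x ≠ y := by
  induction t with
  | leaf => intro a b x y hw h; simp [Ou] at h; simp only [WF] at hw; grind
  | node c l r ihl ihr =>
    intro a b x y hw h
    simp only [WF] at hw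
    simp only [Ou, Finset.mem_union] at h
    simp only [In, Finset.mem_insert, Finset.mem_union]
    obtain ⟨h1, h2, h3, h4, h5, h6, h7, h8, h9, h10, h11, h12⟩ := hw
    rcases h with h | h
    · have := ihl h11 h; grind
    · have := ihr h12 h; grind

lemma d2_sub (t : Tr) : D2 t ⊆ In t := by
  induction t with
  | leaf => simp [D2]
  | node c l r ihl ihr =>
    cases l with
    | leaf => cases r with
      | leaf => simp [D2, In]
      | node c' l' r' => simp only [D2] at *; simp only [In] at *; grind
    | node c' l' r' => simp only [D2] at *; simp only [In] at *; grind

lemma d2_node {c : ℕ} {l r : Tr} (h : ¬ (l = .leaf ∧ r = .leaf)) :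
    D2 (.node c l r) = D2 l ∪ D2 r := by
  cases l <;> cases r <;> simp_all [D2]

lemma d2_deg {t : Tr} : ∀ {a b x : ℕ}, WF t a b → x ∈ D2 t →
    ∃ p q, p ≠ q ∧ ∀ y, s(x, y) ∈ Ed t a b ↔ y = p ∨ y = q := by
  induction t with
  | leaf => intro a b x _ h; simp [D2] at h
  | node c l r ihl ihr =>
    intro a b x hw hx
    have hw' := hw
    simp only [WF] at hw
    obtain ⟨h1, h2, h3, h4, h5, h6, h7, h8, h9, h10, h11, h12⟩ := hw
    by_cases hl : l = .leaf ∧ r = .leaf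
    · obtain ⟨rfl, rfl⟩ := hl
      simp only [D2, Finset.mem_singleton] at hx
      subst hx
      refine ⟨a, b, h1, fun y => ?_⟩
      simp only [Ed, Finset.mem_insert, Finset.mem_union, Sym2.eq_iff, Finset.notMem_empty]
      grind
    · rw [d2_node hl, Finset.mem_union] at hx
      rw [Finset.disjoint_left] at h10
      rcases hx with hx | hx
      · obtain ⟨p, q, hpq, H⟩ := ihl h11 hx
        have hi := d2_sub _ hx
        refine ⟨p, q, hpq, fun y => ?_⟩
        rw [← H y]
        simp only [Ed, Finset.mem_insert, Finset.mem_union, Sym2.eq_iff]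
        have := @ed_supp r c b x y h12
        grind
      · obtain ⟨p, q, hpq, H⟩ := ihr h12 hx
        have hi := d2_sub _ hx
        refine ⟨p, q, hpq, fun y => ?_⟩
        rw [← H y]
        simp only [Ed, Finset.mem_insert, Finset.mem_union, Sym2.eq_iff]
        have := @ed_supp l a c x y h11
        grind

lemma grow_tr {u v w : ℕ} {t : Tr} : ∀ {a b : ℕ}, WF t a b → s(u, v) ∈ Ou t a b → w ∉ In t →
    w ≠ a → w ≠ b → ∃ t', WF t' a b ∧ t' ≠ .leaf ∧ In t' = insert w (In t) ∧
      (∀ e, e ∈ Ed t' a b ↔ e = s(u, w) ∨ e = s(v, w) ∨ e ∈ Ed t a b) ∧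
      (∀ e, e ∈ Ou t a b → e = s(u, v) ∨ e ∈ Ou t' a b) ∧
      s(u, w) ∈ Ou t' a b ∧ s(v, w) ∈ Ou t' a b := by
  induction t with
  | leaf =>
    intro a b hw ho h1 h2 h3
    refine ⟨.node w .leaf .leaf, ?_, by simp, by simp [In], ?_, ?_, ?_⟩
    · simp only [WF] at *; simp [In]; grind
    · intro e
      simp only [Ou, Finset.mem_singleton, Sym2.eq_iff] at ho
      simp only [Ed, Finset.mem_insert, Finset.mem_union, Finset.notMem_empty]
      have := @Sym2.eq_swap _ w b
      have := @Sym2.eq_swap _ w a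
      grind
    · intro e he
      simp only [Ou, Finset.mem_singleton] at *
      grind
    · simp only [Ou, Finset.mem_singleton, Sym2.eq_iff] at ho
      simp only [Ou, Finset.mem_union, Finset.mem_singleton, Sym2.eq_iff]
      grind
  | node c l r ihl ihr =>
    intro a b hw ho h1 h2 h3
    simp only [WF] at hw
    obtain ⟨g1, g2, g3, g4, g5, g6, g7, g8, g9, g10, g11, g12⟩ := hw
    simp only [In, Finset.mem_insert, Finset.mem_union, not_or] at h1
    obtain ⟨h1, h1l, h1r⟩ := h1
    rw [Finset.disjoint_left] at g10
    simp only [Ou, Finset.mem_union] at ho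
    rcases ho with ho | ho
    · obtain ⟨t', k1, k2, k3, k4, k5, k6, k7⟩ := ihl g11 ho h1l h2 h1
      refine ⟨.node c t' r, ?_, by simp, ?_, ?_, ?_, ?_, ?_⟩
      · simp only [WF, Finset.disjoint_left, k3]; grind
      · simp only [In, k3]; grind
      · intro e; simp only [Ed, Finset.mem_insert, Finset.mem_union, k4]; tauto
      · intro e; simp only [Ou, Finset.mem_union]; grind
      · simp only [Ou, Finset.mem_union]; grind
      · simp only [Ou, Finset.mem_union]; grind
    · obtain ⟨t', k1, k2, k3, k4, k5, k6, k7⟩ := ihr g12 ho h1r h1 h3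
      refine ⟨.node c l t', ?_, by simp, ?_, ?_, ?_, ?_, ?_⟩
      · simp only [WF, Finset.disjoint_left, k3]; grind
      · simp only [In, k3]; grind
      · intro e; simp only [Ed, Finset.mem_insert, Finset.mem_union, k4]; tauto
      · intro e; simp only [Ou, Finset.mem_union]; grind
      · simp only [Ou, Finset.mem_union]; grind
      · simp only [Ou, Finset.mem_union]; grind

/-- `G` is the union of two nontrivial trees glued along the edge `ab`. -/
def Rep (G : SimpleGraph ℕ) (V : Finset ℕ) (C : Finset (Sym2 ℕ)) : Prop :=
  ∃ a b t₁ t₂, WF t₁ a b ∧ WF t₂ a b ∧ Disjoint (In t₁) (In t₂) ∧ t₁ ≠ .leaf ∧ t₂ ≠ .leaf ∧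
    V = insert a (insert b (In t₁ ∪ In t₂)) ∧
    (∀ x y, G.Adj x y ↔ s(x, y) = s(a, b) ∨ s(x, y) ∈ Ed t₁ a b ∨ s(x, y) ∈ Ed t₂ a b) ∧
    ∀ e ∈ C, e ∈ Ou t₁ a b ∨ e ∈ Ou t₂ a b

/-- `G` is a triangle. -/
def Tri (G : SimpleGraph ℕ) (V : Finset ℕ) (C : Finset (Sym2 ℕ)) : Prop :=
  ∀ u v, s(u, v) ∈ C → ∃ c, u ≠ v ∧ u ≠ c ∧ v ≠ c ∧ V = {u, v, c} ∧
    (∀ x y, G.Adj x y ↔ s(x, y) = s(u, v) ∨ s(x, y) = s(u, c) ∨ s(x, y) = s(c, v)) ∧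
    ∀ e ∈ C, e = s(u, v) ∨ e = s(u, c) ∨ e = s(c, v)

lemma ne_of_pair {x y a b : ℕ} (h : s(x, y) = s(a, b)) (hab : a ≠ b) : x ≠ y := by
  rw [Sym2.eq_iff] at h; grind

set_option maxHeartbeats 1000000 in
lemma rep_or_tri {G : SimpleGraph ℕ} {V : Finset ℕ} {C : Finset (Sym2 ℕ)}
    (h : IsMopCycle G V C) : (V.card = 3 ∧ Tri G V C) ∨ Rep G V C := by
  induction h with
  | triangle a b c hab hac hbc =>
    left
    refine ⟨by grind, ?_⟩
    intro u v huv
    simp only [Finset.mem_insert, Finset.mem_singleton, Sym2.eq_iff] at huv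
    have hadj : ∀ x y, (SimpleGraph.fromEdgeSet {s(a, b), s(b, c), s(a, c)}).Adj x y ↔
        s(x, y) = s(a, b) ∨ s(x, y) = s(b, c) ∨ s(x, y) = s(a, c) := by
      intro x y
      simp only [SimpleGraph.fromEdgeSet_adj, Set.mem_insert_iff, Set.mem_singleton_iff,
        Sym2.eq_iff]
      grind
    simp only [hadj, Finset.mem_insert, Finset.mem_singleton]
    have s1 := @Sym2.eq_swap _ a b
    have s2 := @Sym2.eq_swap _ a c
    have s3 := @Sym2.eq_swap _ b c
    rcases huv with (⟨rfl, rfl⟩ | ⟨rfl, rfl⟩) | (⟨rfl, rfl⟩ | ⟨rfl, rfl⟩) | (⟨rfl, rfl⟩ | ⟨rfl, rfl⟩)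
    · exact ⟨c, by grind⟩
    · exact ⟨c, by grind⟩
    · exact ⟨a, by grind⟩
    · exact ⟨a, by grind⟩
    · exact ⟨b, by grind⟩
    · exact ⟨b, by grind⟩
  | grow G V C u v w hG huv hw ih =>
    right
    rcases ih with ⟨-, ih⟩ | ih
    · obtain ⟨c, h1, h2, h3, hV, hA, hC⟩ := ih u v huv
      refine ⟨u, v, .node c .leaf .leaf, .node w .leaf .leaf, ?_, ?_, ?_, by simp, by simp, ?_,
        ?_, ?_⟩
      · simp only [WF, In]; simp; grind
      · simp only [WF, In]; simp; grind
      · simp [In]; grind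
      · simp only [In]; grind
      · intro x y
        simp only [SimpleGraph.fromEdgeSet_adj, Set.mem_insert_iff, SimpleGraph.mem_edgeSet, hA,
          Ed, Finset.mem_insert, Finset.mem_union, Finset.notMem_empty]
        rw [@Sym2.eq_swap _ w v]
        subst hV
        simp only [Finset.mem_insert, Finset.mem_singleton, not_or] at hw
        have e1 := fun h => @ne_of_pair x y u v h h1
        have e2 := fun h => @ne_of_pair x y u c h h2
        have e3 := fun h => @ne_of_pair x y c v h h3.symm
        have e4 := fun h => @ne_of_pair x y u w h (by tauto)
        have e5 := fun h => @ne_of_pair x y v w h (by tauto)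
        clear hA hC
        generalize (s(x, y) = s(u, v)) = p1 at *
        generalize (s(x, y) = s(u, c)) = p2 at *
        generalize (s(x, y) = s(c, v)) = p3 at *
        generalize (s(x, y) = s(u, w)) = p4 at *
        generalize (s(x, y) = s(v, w)) = p5 at *
        clear hw huv ih hG
        constructor
        · tauto
        · tauto
      · intro e he
        simp only [Finset.mem_insert, Finset.mem_erase] at he
        simp only [Ou, Finset.mem_union, Finset.mem_singleton]
        have := @Sym2.eq_swap _ w v
        grind
    · obtain ⟨a, b, t₁, t₂, w1, w2, hd, n1, n2, hV, hA, hC⟩ := ih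
      rw [Finset.disjoint_left] at hd
      subst hV
      simp only [Finset.mem_insert, Finset.mem_union, not_or] at hw
      obtain ⟨hwa, hwb, hwi1, hwi2⟩ := hw
      rcases hC _ huv with ho | ho
      · have hs := ou_supp w1 ho
        obtain ⟨t', k1, k2, k3, k4, k5, k6, k7⟩ := grow_tr w1 ho hwi1 hwa hwb
        refine ⟨a, b, t', t₂, k1, w2, ?_, k2, n2, ?_, ?_, ?_⟩
        · rw [Finset.disjoint_left, k3]; grind
        · rw [k3]; grind
        · intro x y
          simp only [SimpleGraph.fromEdgeSet_adj, Set.mem_insert_iff, SimpleGraph.mem_edgeSet, hA,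
            k4]
          have e1 := fun h => (@ed_supp t₁ a b x y w1 h).2.2.1
          have e2 := fun h => (@ed_supp t₂ a b x y w2 h).2.2.1
          have e3 := fun h => @ne_of_pair x y a b h w1.ne
          have e4 := fun h => @ne_of_pair x y u w h (by rintro rfl; tauto)
          have e5 := fun h => @ne_of_pair x y v w h (by rintro rfl; tauto)
          clear k4 k5 hA hC k1 k2 k3 k6 k7 hs
          generalize (s(x, y) = s(a, b)) = p1 at *
          generalize (s(x, y) = s(u, w)) = p4 at *
          generalize (s(x, y) = s(v, w)) = p5 at *
          generalize (s(x, y) ∈ Ed t₁ a b) = p2 at *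
          generalize (s(x, y) ∈ Ed t₂ a b) = p3 at *
          clear huv hG ho hwa hwb hwi1 hwi2 hd
          constructor
          · tauto
          · tauto
        · intro e he
          simp only [Finset.mem_insert, Finset.mem_erase] at he
          grind
      · have hs := ou_supp w2 ho
        obtain ⟨t', k1, k2, k3, k4, k5, k6, k7⟩ := grow_tr w2 ho hwi2 hwa hwb
        refine ⟨a, b, t₁, t', w1, k1, ?_, n1, k2, ?_, ?_, ?_⟩
        · rw [Finset.disjoint_left, k3]; grind
        · rw [k3]; grind
        · intro x y
          simp only [SimpleGraph.fromEdgeSet_adj, Set.mem_insert_iff, SimpleGraph.mem_edgeSet, hA,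
            k4]
          have e1 := fun h => (@ed_supp t₁ a b x y w1 h).2.2.1
          have e2 := fun h => (@ed_supp t₂ a b x y w2 h).2.2.1
          have e3 := fun h => @ne_of_pair x y a b h w1.ne
          have e4 := fun h => @ne_of_pair x y u w h (by rintro rfl; tauto)
          have e5 := fun h => @ne_of_pair x y v w h (by rintro rfl; tauto)
          clear k4 k5 hA hC k1 k2 k3 k6 k7 hs
          generalize (s(x, y) = s(a, b)) = p1 at *
          generalize (s(x, y) = s(u, w)) = p4 at *
          generalize (s(x, y) = s(v, w)) = p5 at *
          generalize (s(x, y) ∈ Ed t₁ a b) = p2 at *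
          generalize (s(x, y) ∈ Ed t₂ a b) = p3 at *
          clear huv hG ho hwa hwb hwi1 hwi2 hd
          constructor
          · tauto
          · tauto
        · intro e he
          simp only [Finset.mem_insert, Finset.mem_erase] at he
          grind

/-- State of a root vertex: in the set, promised to be dominated from outside,
undominated with at most one (resp. no) undominated neighbour, dominated from inside. -/
inductive St
  | I | P | U1 | U0 | D
  deriving DecidableEq

/-- Kind of an apex vertex: in the set, dominated, possibly undominated. -/
inductive Kd
  | S | Dm | W
  deriving DecidableEq

/-- States for the two roots, and the slack. -/
abbrev Entry := St × St × ℕ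

/-- Compatibility of the states of a root in a subtree and in the tree. -/
def optR (l : St) (k : Kd) (s : St) : Bool :=
  match s with
  | .I => l == .I
  | .P => l == .P
  | .D => l == .D || (l == .P && k == .S)
  | .U0 => l == .D || (l == .P && k == .S) || (l == .U0 && k != .W)
  | .U1 => l == .D || (l == .P && k == .S) || l == .U0 || (l == .U1 && k != .W)

/-- Undominated states. -/
def isU (s : St) : Bool := s == .U0 || s == .U1

/-- Compatibility at the apex. -/
def optC (k : Kd) (la lc rc rb : St) : Bool :=
  match k with
  | .S => lc == .I && rc == .I
  | .Dm => (lc == .P && rc == .P && (la == .I || rb == .I)) || (lc == .D && rc == .P) ||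
      (lc == .P && rc == .D)
  | .W => (lc == .U0 && rc == .U0 && !(isU la && isU rb)) ||
      (!isU la && !isU rb && ((lc == .U1 && rc == .U0) || (lc == .U0 && rc == .U1)))

/-- Cost of the apex. -/
def kcost (k : Kd) : ℕ :=
  match k with
  | .S => 6
  | _ => 0

/-- The entry `e` is achieved by combining the profiles `p` and `q`. -/
def okEntry (p q : List Entry) (dec : ℕ) (e : Entry) : Bool :=
  [Kd.S, Kd.Dm, Kd.W].any fun k =>
    (p.filter fun x => optR x.1 k e.1).any fun x =>
      (q.filter fun y => optR y.2.1 k e.2.1).any fun y =>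
        optC k x.1 x.2.1 y.1 y.2.1 && Nat.ble (e.2.2 + kcost k) (x.2.2 + y.2.2 + dec)

/-- Profile of the trivial tree. -/
def leafVec : List Entry := [
  (.I, .I, 0), (.I, .P, 0), (.I, .U1, 0), (.I, .U0, 0),
  (.P, .I, 0), (.P, .P, 0), (.P, .U1, 0), (.P, .U0, 0),
  (.U1, .I, 0), (.U1, .P, 0), (.U1, .U1, 0), (.U1, .U0, 0),
  (.U0, .I, 0), (.U0, .P, 0), (.U0, .U1, 0), (.U0, .U0, 0)]

/-- The possible profiles of nontrivial trees. -/
def Vecs : List (List Entry) := [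
  [(.I, .I, 2), (.I, .P, 2), (.I, .U1, 2), (.I, .U0, 2), (.P, .I, 2), (.P, .P, 2), (.P, .U1, 2),
    (.U1, .I, 2), (.U1, .P, 2), (.U0, .I, 2)],
  [(.I, .I, 3), (.I, .P, 3), (.I, .U1, 3), (.P, .I, 3), (.P, .P, 3), (.U1, .I, 3), (.U0, .I, 3)],
  [(.I, .I, 3), (.I, .P, 3), (.I, .U1, 3), (.I, .U0, 3), (.P, .I, 3), (.P, .P, 3), (.U1, .I, 3)],
  [(.I, .I, 5), (.I, .P, 5), (.I, .U1, 5), (.P, .I, 5), (.U1, .I, 5)],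
  [(.I, .I, 4), (.I, .P, 4), (.P, .I, 4), (.U1, .I, 4), (.U0, .I, 4)],
  [(.I, .I, 4), (.I, .P, 4), (.I, .U1, 4), (.I, .U0, 4), (.P, .I, 4)],
  [(.I, .I, 5), (.P, .I, 5), (.U1, .I, 5), (.U0, .I, 5)],
  [(.I, .I, 5), (.I, .P, 5), (.I, .U1, 5), (.I, .U0, 5)],
  [(.I, .I, 0), (.I, .P, 0), (.I, .U1, 0), (.I, .U0, 0), (.I, .D, 0), (.P, .I, 0), (.P, .P, 0),
    (.P, .U1, 0), (.P, .U0, 0), (.P, .D, 0), (.U1, .I, 0), (.U1, .P, 0), (.U1, .U1, 0), (.U1,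
    .U0, 0), (.U1, .D, 0), (.U0, .I, 0), (.U0, .P, 0), (.U0, .U1, 0), (.U0, .U0, 0), (.U0, .D,
    0), (.D, .I, 0), (.D, .P, 0), (.D, .U1, 0), (.D, .U0, 0), (.D, .D, 0)],
  [(.I, .I, 8), (.P, .I, 5), (.U1, .I, 5), (.U0, .I, 2), (.D, .I, 2)],
  [(.I, .I, 9), (.P, .I, 5), (.U1, .I, 3), (.U0, .I, 3), (.D, .I, 3)],
  [(.I, .I, 8), (.I, .P, 5), (.I, .U1, 5), (.I, .U0, 2), (.I, .D, 2)],
  [(.I, .I, 9), (.I, .P, 5), (.I, .U1, 3), (.I, .U0, 3), (.I, .D, 3)],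
  [(.I, .I, 10)],
  [(.I, .I, 1), (.I, .P, 1), (.I, .U1, 1), (.I, .U0, 1), (.I, .D, 1), (.P, .I, 1), (.P, .P, 1),
    (.P, .U1, 1), (.P, .U0, 1), (.P, .D, 1), (.U1, .I, 1), (.U1, .P, 1), (.U1, .U1, 1), (.U1,
    .U0, 1), (.U1, .D, 1), (.U0, .I, 1), (.U0, .P, 1), (.U0, .U1, 1), (.U0, .U0, 1), (.U0, .D,
    1)],
  [(.I, .I, 1), (.I, .P, 1), (.I, .U1, 1), (.I, .U0, 1), (.P, .I, 1), (.P, .P, 1), (.P, .U1, 1),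
    (.P, .U0, 1), (.U1, .I, 1), (.U1, .P, 1), (.U1, .U1, 1), (.U1, .U0, 1), (.U0, .I, 1), (.U0,
    .P, 1), (.U0, .U1, 1), (.U0, .U0, 1), (.D, .I, 1), (.D, .P, 1), (.D, .U1, 1), (.D, .U0, 1)]]

/-- Some profile is achieved by combining `p` and `q`. -/
def okPair (p q : List Entry) (dec : ℕ) : Bool :=
  Vecs.any fun r => r.all (okEntry p q dec)

lemma check_ll : okPair leafVec leafVec 2 = true := by decide +kernel

lemma check_lv : (Vecs.all fun q => okPair leafVec q 1) = true := by decide +kernel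

lemma check_vl : (Vecs.all fun p => okPair p leafVec 1) = true := by decide +kernel

lemma check_vv : (Vecs.all fun p => Vecs.all fun q => okPair p q 1) = true := by decide +kernel

/-- Compatibility of the states of a root in the final gluing. -/
def okF (p q op oq : St) : Bool :=
  (p == .I && q == .I) || (p == .P && q == .P && op == .I) || (p == .D && q == .P) ||
    (p == .P && q == .D) || (p == .U0 && q == .U0) ||
    (!(isU op && isU oq) && ((p == .U1 && q == .U0) || (p == .U0 && q == .U1)))

/-- Cost of a root in the final gluing. -/
def rcost (p : St) : ℕ :=
  match p with
  | .I => 6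
  | _ => 0

/-- The final gluing of `p` and `q` works. -/
def okFin (p q : List Entry) : Bool :=
  p.any fun x => q.any fun y => okF x.1 y.1 x.2.1 y.2.1 && okF x.2.1 y.2.1 x.1 y.1 &&
    Nat.ble (rcost x.1 + rcost x.2.1) (x.2.2 + y.2.2 + 2)

lemma check_fin : (Vecs.all fun p => Vecs.all fun q => okFin p q) = true := by decide +kernel

/-- `x` is in the set. -/
def NS (a b : ℕ) (S : Finset ℕ) (sa sb : St) (x : ℕ) : Prop :=
  x ∈ S ∨ (x = a ∧ sa = .I) ∨ (x = b ∧ sb = .I)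

/-- `x` is undominated. -/
def Un (a b : ℕ) (t : Tr) (S : Finset ℕ) (sa sb : St) (x : ℕ) : Prop :=
  ¬ NS a b S sa sb x ∧ ¬ (x = a ∧ (sa = .P ∨ sa = .D)) ∧ ¬ (x = b ∧ (sb = .P ∨ sb = .D)) ∧
    ∀ y, s(x, y) ∈ Ed t a b → ¬ NS a b S sa sb y

/-- Conditions at a root. -/
def RootOK (E : ℕ → Prop) (ns un : ℕ → Prop) (x : ℕ) (s : St) : Prop :=
  (s = .D → ∃ y, E y ∧ ns y) ∧ (s = .U0 → un x → ∀ y, E y → ¬ un y) ∧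
    (s = .U1 → un x → ∀ y z, E y → E z → un y → un z → y = z)

/-- `S` is feasible for the given states. -/
def Feas (a b : ℕ) (t : Tr) (S : Finset ℕ) (sa sb : St) : Prop :=
  (∀ x ∈ In t, Un a b t S sa sb x → ∀ y z, s(x, y) ∈ Ed t a b → s(x, z) ∈ Ed t a b →
    Un a b t S sa sb y → Un a b t S sa sb z → y = z) ∧
  RootOK (fun y => s(a, y) ∈ Ed t a b) (NS a b S sa sb) (Un a b t S sa sb) a sa ∧
  RootOK (fun y => s(b, y) ∈ Ed t a b) (NS a b S sa sb) (Un a b t S sa sb) b sb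

lemma root_step {EL EH nl nh ul uh : ℕ → Prop} {x c : ℕ} {l s : St} {k : Kd}
    (hE : ∀ y, EH y ↔ EL y ∨ y = c) (hn : ∀ y, EL y → (nl y ↔ nh y))
    (hu : ∀ y, EL y → uh y → ul y) (hx : uh x → ul x) (hPD : ul x → l ≠ .P ∧ l ≠ .D)
    (hS : k = .S → nh c) (hW : k ≠ .W → ¬ uh c) (ho : optR l k s = true)
    (hL : RootOK EL nl ul x l) : RootOK EH nh uh x s := by
  obtain ⟨h1, h2, h3⟩ := hL
  refine ⟨?_, ?_, ?_⟩
  · rintro rfl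
    simp only [optR, Bool.or_eq_true, Bool.and_eq_true, beq_iff_eq] at ho
    rcases ho with ho | ⟨ho, hk⟩
    · obtain ⟨y, hy, hy'⟩ := h1 ho
      exact ⟨y, (hE y).2 (Or.inl hy), (hn y hy).1 hy'⟩
    · exact ⟨c, (hE c).2 (Or.inr rfl), hS hk⟩
  · rintro rfl hux y hy huy
    simp only [optR, Bool.or_eq_true, Bool.and_eq_true, beq_iff_eq, bne_iff_ne] at ho
    have := hPD (hx hux)
    have ⟨hl, hk⟩ : l = .U0 ∧ k ≠ .W := by tauto
    rcases (hE y).1 hy with hy | rfl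
    · exact h2 hl (hx hux) y hy (hu y hy huy)
    · exact hW hk huy
  · rintro rfl hux y z hy hz huy huz
    simp only [optR, Bool.or_eq_true, Bool.and_eq_true, beq_iff_eq, bne_iff_ne] at ho
    have := hPD (hx hux)
    have hl : l = .U0 ∨ (l = .U1 ∧ k ≠ .W) := by tauto
    rcases hl with hl | ⟨hl, hk⟩
    · rcases (hE y).1 hy with hy | rfl
      · exact absurd (hu y hy huy) (h2 hl (hx hux) y hy)
      · rcases (hE z).1 hz with hz | rfl
        · exact absurd (hu z hz huz) (h2 hl (hx hux) z hz)
        · rfl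
    · rcases (hE y).1 hy with hy | rfl
      · rcases (hE z).1 hz with hz | rfl
        · exact h3 hl (hx hux) y z hy hz (hu y hy huy) (hu z hz huz)
        · exact absurd huz (hW hk)
      · exact absurd huy (hW hk)

lemma optR_I {l s : St} {k : Kd} (h : optR l k s = true) : s = .I ↔ l = .I := by
  cases l <;> cases s <;> cases k <;> simp_all [optR]

lemma isU_of {s : St} (h : s ≠ .P ∧ s ≠ .D) (h' : s ≠ .I) : isU s = true := by
  cases s <;> simp_all [isU]

lemma optR_P {p s : St} {k : Kd} (h : optR p k s = true) (hp : p = .P) :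
    s = .P ∨ k = .S ∨ s = .D := by
  subst hp
  cases s <;> cases k <;> simp_all [optR]

lemma optC_S {la lc rc rb : St} {k : Kd} (h : optC k la lc rc rb = true) :
    (k = .S ↔ lc = .I) ∧ (k = .S ↔ rc = .I) := by
  cases k <;> cases lc <;> cases rc <;> simp_all [optC]

lemma optC_W {la lc rc rb : St} {k : Kd} (h : optC k la lc rc rb = true) :
    (lc = .P ∨ lc = .D → k ≠ .W) ∧ (rc = .P ∨ rc = .D → k ≠ .W) := by
  cases k <;> cases lc <;> cases rc <;> simp_all [optC]

set_option maxHeartbeats 1000000 in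
lemma comb {a b c : ℕ} {l r : Tr} {SL SR : Finset ℕ} {la lc rc rb sa sb : St} {k : Kd}
    (hw : WF (.node c l r) a b) (hSL : SL ⊆ In l) (hSR : SR ⊆ In r)
    (FL : Feas a c l SL la lc) (FR : Feas c b r SR rc rb)
    (h1 : optR la k sa = true) (h2 : optR rb k sb = true) (h3 : optC k la lc rc rb = true) :
    Feas a b (.node c l r) (SL ∪ SR ∪ if k = .S then {c} else ∅) sa sb := by
  simp only [WF] at hw
  obtain ⟨hab, hac, hcb, hal, har, hbl, hbr, hcl, hcr, hd, wl, wr⟩ := hw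
  rw [Finset.disjoint_left] at hd
  have i1 := optR_I h1
  have i2 := optR_I h2
  have kc : (k = .S ↔ lc = .I) ∧ (k = .S ↔ rc = .I) := optC_S h3
  set S := SL ∪ SR ∪ (if k = .S then {c} else ∅) with hS
  have memS : ∀ x, x ∈ S ↔ x ∈ SL ∨ x ∈ SR ∨ (x = c ∧ k = .S) := by
    intro x; rw [hS]; clear * -; split_ifs with hk <;> simp [hk] <;> tauto
  have VE : ∀ x y, s(x, y) ∈ Ed (.node c l r) a b ↔
      s(x, y) = s(a, c) ∨ s(x, y) = s(c, b) ∨ s(x, y) ∈ Ed l a c ∨ s(x, y) ∈ Ed r c b := by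
    intro x y; simp only [Ed, Finset.mem_insert, Finset.mem_union]
  have suppL := fun x y => @ed_supp l a c x y wl
  have suppR := fun x y => @ed_supp r c b x y wr
  have aSL : a ∉ SL := fun h => hal (hSL h)
  have aSR : a ∉ SR := fun h => har (hSR h)
  have bSL : b ∉ SL := fun h => hbl (hSL h)
  have bSR : b ∉ SR := fun h => hbr (hSR h)
  have cSL : c ∉ SL := fun h => hcl (hSL h)
  have cSR : c ∉ SR := fun h => hcr (hSR h)
  -- membership
  have F1 : ∀ x, (x = a ∨ x = c ∨ x ∈ In l) → (NS a c SL la lc x ↔ NS a b S sa sb x) := by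
    intro x hx
    simp only [NS, memS]
    rcases hx with rfl | rfl | hx
    · simp [aSL, aSR, hac, hab, i1]
    · simp [cSL, cSR, hac.symm, hcb, kc.1]
    · have e1 : x ≠ a := by rintro rfl; exact hal hx
      have e2 : x ≠ b := by rintro rfl; exact hbl hx
      have e3 : x ≠ c := by rintro rfl; exact hcl hx
      have e4 : x ∉ SR := fun h => hd hx (hSR h)
      simp [e1, e2, e3, e4]
  have F2 : ∀ x, (x = c ∨ x = b ∨ x ∈ In r) → (NS c b SR rc rb x ↔ NS a b S sa sb x) := by
    intro x hx
    simp only [NS, memS]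
    rcases hx with rfl | rfl | hx
    · simp [cSL, cSR, hac.symm, hcb, kc.2]
    · simp [bSL, bSR, hcb.symm, hab.symm, i2]
    · have e1 : x ≠ a := by rintro rfl; exact har hx
      have e2 : x ≠ b := by rintro rfl; exact hbr hx
      have e3 : x ≠ c := by rintro rfl; exact hcr hx
      have e4 : x ∉ SL := fun h => hd (hSL h) hx
      simp [e1, e2, e3, e4]
  have toL : ∀ x y, s(x, y) ∈ Ed l a c → s(x, y) ∈ Ed (.node c l r) a b :=
    fun x y h => (VE x y).2 (Or.inr (Or.inr (Or.inl h)))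
  have toR : ∀ x y, s(x, y) ∈ Ed r c b → s(x, y) ∈ Ed (.node c l r) a b :=
    fun x y h => (VE x y).2 (Or.inr (Or.inr (Or.inr h)))
  have eac : s(a, c) ∈ Ed (.node c l r) a b := (VE a c).2 (Or.inl rfl)
  have eca : s(c, a) ∈ Ed (.node c l r) a b := (VE c a).2 (Or.inl Sym2.eq_swap)
  have ecb : s(c, b) ∈ Ed (.node c l r) a b := (VE c b).2 (Or.inr (Or.inl rfl))
  have ebc : s(b, c) ∈ Ed (.node c l r) a b := (VE b c).2 (Or.inr (Or.inl Sym2.eq_swap))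
  obtain ⟨L1, L2, L3⟩ := FL
  obtain ⟨R1, R2, R3⟩ := FR
  have nsc : k = .S → NS a b S sa sb c := fun hk => Or.inl ((memS c).2 (Or.inr (Or.inr ⟨rfl, hk⟩)))
  -- domination certificates
  have dLa : la = .D → ∃ y, s(a, y) ∈ Ed (.node c l r) a b ∧ NS a b S sa sb y := by
    intro h
    obtain ⟨y, hy, hy'⟩ := L2.1 h
    exact ⟨y, toL _ _ hy, (F1 y (suppL _ _ hy).2.1).1 hy'⟩
  have dLc : lc = .D → ∃ y, s(c, y) ∈ Ed (.node c l r) a b ∧ NS a b S sa sb y := by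
    intro h
    obtain ⟨y, hy, hy'⟩ := L3.1 h
    exact ⟨y, toL _ _ hy, (F1 y (suppL _ _ hy).2.1).1 hy'⟩
  have dRc : rc = .D → ∃ y, s(c, y) ∈ Ed (.node c l r) a b ∧ NS a b S sa sb y := by
    intro h
    obtain ⟨y, hy, hy'⟩ := R2.1 h
    exact ⟨y, toR _ _ hy, (F2 y (suppR _ _ hy).2.1).1 hy'⟩
  have dRb : rb = .D → ∃ y, s(b, y) ∈ Ed (.node c l r) a b ∧ NS a b S sa sb y := by
    intro h
    obtain ⟨y, hy, hy'⟩ := R3.1 h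
    exact ⟨y, toR _ _ hy, (F2 y (suppR _ _ hy).2.1).1 hy'⟩
  have noD : ∀ x, Un a b (.node c l r) S sa sb x →
      ¬ ∃ y, s(x, y) ∈ Ed (.node c l r) a b ∧ NS a b S sa sb y := by
    rintro x hx ⟨y, hy, hy'⟩
    exact hx.2.2.2 y hy hy'
  have nsa : la = .I → NS a b S sa sb a := fun h => Or.inr (Or.inl ⟨rfl, i1.2 h⟩)
  have nsb : rb = .I → NS a b S sa sb b := fun h => Or.inr (Or.inr ⟨rfl, i2.2 h⟩)
  have C1 : k = .Dm → ∃ y, s(c, y) ∈ Ed (.node c l r) a b ∧ NS a b S sa sb y := by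
    rintro rfl
    simp only [optC, Bool.or_eq_true, Bool.and_eq_true, beq_iff_eq] at h3
    rcases h3 with (⟨-, h | h⟩ | ⟨h, -⟩) | ⟨-, h⟩
    · exact ⟨a, eca, nsa h⟩
    · exact ⟨b, ecb, nsb h⟩
    · exact dLc h
    · exact dRc h
  have C2 := optC_W h3
  have Unc : Un a b (.node c l r) S sa sb c → k = .W := by
    intro h
    cases hk : k with
    | S => exact absurd (nsc hk) h.1
    | Dm => exact absurd (C1 hk) (noD c h)
    | W => rfl
  have Una : Un a b (.node c l r) S sa sb a → la ≠ .P ∧ la ≠ .D := by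
    intro h
    refine ⟨fun hp => ?_, fun hp => noD a h (dLa hp)⟩
    rcases optR_P h1 hp with h' | h' | h'
    · exact h.2.1 ⟨rfl, Or.inl h'⟩
    · exact noD a h ⟨c, eac, nsc h'⟩
    · exact h.2.1 ⟨rfl, Or.inr h'⟩
  have Unb : Un a b (.node c l r) S sa sb b → rb ≠ .P ∧ rb ≠ .D := by
    intro h
    refine ⟨fun hp => ?_, fun hp => noD b h (dRb hp)⟩
    rcases optR_P h2 hp with h' | h' | h'
    · exact h.2.2.1 ⟨rfl, Or.inl h'⟩
    · exact noD b h ⟨c, ebc, nsc h'⟩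
    · exact h.2.2.1 ⟨rfl, Or.inr h'⟩
  have F3 : ∀ x, (x = a ∨ x = c ∨ x ∈ In l) → Un a b (.node c l r) S sa sb x →
      Un a c l SL la lc x := by
    intro x hx hu
    refine ⟨fun h => hu.1 ((F1 x hx).1 h), ?_, ?_, ?_⟩
    · rintro ⟨rfl, h⟩
      exact h.elim (Una hu).1 (Una hu).2
    · rintro ⟨rfl, h⟩
      exact C2.1 h (Unc hu)
    · intro y hy hn
      exact noD x hu ⟨y, toL _ _ hy, (F1 y (suppL _ _ hy).2.1).1 hn⟩
  have F4 : ∀ x, (x = c ∨ x = b ∨ x ∈ In r) → Un a b (.node c l r) S sa sb x →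
      Un c b r SR rc rb x := by
    intro x hx hu
    refine ⟨fun h => hu.1 ((F2 x hx).1 h), ?_, ?_, ?_⟩
    · rintro ⟨rfl, h⟩
      exact C2.2 h (Unc hu)
    · rintro ⟨rfl, h⟩
      exact h.elim (Unb hu).1 (Unb hu).2
    · intro y hy hn
      exact noD x hu ⟨y, toR _ _ hy, (F2 y (suppR _ _ hy).2.1).1 hn⟩
  have nW : k ≠ .W → ¬ Un a b (.node c l r) S sa sb c := fun hk hu => hk (Unc hu)
  refine ⟨?_, ?_, ?_⟩
  · intro x hx hu y z hy hz huy huz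
    simp only [In, Finset.mem_insert, Finset.mem_union] at hx
    rcases hx with rfl | hx | hx
    · -- the apex
      have hk := Unc hu
      subst hk
      have hLc : Un a x l SL la lc x := F3 x (Or.inr (Or.inl rfl)) hu
      have hRc : Un x b r SR rc rb x := F4 x (Or.inl rfl) hu
      have ua : Un a b (.node x l r) S sa sb a → isU la = true := by
        intro h
        have q1 := Una h
        have q2 : la ≠ .I := fun q => h.1 (nsa q)
        exact isU_of q1 q2
      have ub : Un a b (.node x l r) S sa sb b → isU rb = true := by
        intro h
        have q1 := Unb h
        have q2 : rb ≠ .I := fun q => h.1 (nsb q)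
        exact isU_of q1 q2
      have cls : ∀ y, s(x, y) ∈ Ed (.node x l r) a b → Un a b (.node x l r) S sa sb y →
          (y = a ∧ isU la = true) ∨ (y = b ∧ isU rb = true) ∨
          (s(x, y) ∈ Ed l a x ∧ Un a x l SL la lc y) ∨
          (s(x, y) ∈ Ed r x b ∧ Un x b r SR rc rb y) := by
        intro y hy hu
        rcases (VE x y).1 hy with h | h | h | h
        · have : y = a := by rw [Sym2.eq_iff] at h; grind
          subst this; exact Or.inl ⟨rfl, ua hu⟩
        · have : y = b := by rw [Sym2.eq_iff] at h; grind
          subst this; exact Or.inr (Or.inl ⟨rfl, ub hu⟩)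
        · exact Or.inr (Or.inr (Or.inl ⟨h, F3 y (suppL _ _ h).2.1 hu⟩))
        · exact Or.inr (Or.inr (Or.inr ⟨h, F4 y (suppR _ _ h).2.1 hu⟩))
      have l0 : lc = .U0 → ∀ y, s(x, y) ∈ Ed l a x → ¬ Un a x l SL la lc y :=
        fun h => L3.2.1 h hLc
      have l1 : lc = .U1 → ∀ y z, s(x, y) ∈ Ed l a x → s(x, z) ∈ Ed l a x →
        Un a x l SL la lc y → Un a x l SL la lc z → y = z := fun h => L3.2.2 h hLc
      have r0 : rc = .U0 → ∀ y, s(x, y) ∈ Ed r x b → ¬ Un x b r SR rc rb y :=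
        fun h => R2.2.1 h hRc
      have r1 : rc = .U1 → ∀ y z, s(x, y) ∈ Ed r x b → s(x, z) ∈ Ed r x b →
        Un x b r SR rc rb y → Un x b r SR rc rb z → y = z := fun h => R2.2.2 h hRc
      have cy := cls y hy huy
      have cz := cls z hz huz
      simp only [optC, Bool.or_eq_true, Bool.and_eq_true, beq_iff_eq, Bool.not_eq_true',
        Bool.and_eq_false_iff] at h3
      rcases h3 with ⟨⟨e1, e2⟩, e3⟩ | ⟨⟨e3, e4⟩, ⟨e1, e2⟩ | ⟨e1, e2⟩⟩
      · have g1 := l0 e1 y; have g2 := l0 e1 z; have g3 := r0 e2 y; have g4 := r0 e2 z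
        clear * - cy cz e3 g1 g2 g3 g4
        grind
      · have g1 := l1 e1 y z; have g2 := r0 e2 y; have g3 := r0 e2 z
        clear * - cy cz e3 e4 g1 g2 g3
        grind
      · have g1 := r1 e2 y z; have g2 := l0 e1 y; have g3 := l0 e1 z
        clear * - cy cz e3 e4 g1 g2 g3
        grind
    · have key : ∀ y, s(x, y) ∈ Ed (.node c l r) a b → s(x, y) ∈ Ed l a c := by
        intro y hy
        rcases (VE x y).1 hy with h | h | h | h
        · rw [Sym2.eq_iff] at h; exfalso; grind
        · rw [Sym2.eq_iff] at h; exfalso; grind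
        · exact h
        · have := (suppR _ _ h).1; exfalso; grind
      have hy' := key y hy
      have hz' := key z hz
      exact L1 x hx (F3 x (Or.inr (Or.inr hx)) hu) y z hy' hz' (F3 y (suppL _ _ hy').2.1 huy)
        (F3 z (suppL _ _ hz').2.1 huz)
    · have key : ∀ y, s(x, y) ∈ Ed (.node c l r) a b → s(x, y) ∈ Ed r c b := by
        intro y hy
        rcases (VE x y).1 hy with h | h | h | h
        · rw [Sym2.eq_iff] at h; exfalso; grind
        · rw [Sym2.eq_iff] at h; exfalso; grind
        · have := (suppL _ _ h).1; exfalso; grind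
        · exact h
      have hy' := key y hy
      have hz' := key z hz
      exact R1 x hx (F4 x (Or.inr (Or.inr hx)) hu) y z hy' hz' (F4 y (suppR _ _ hy').2.1 huy)
        (F4 z (suppR _ _ hz').2.1 huz)
  · refine root_step (c := c) (k := k) (l := la) ?_ ?_ ?_ (F3 a (Or.inl rfl)) ?_ nsc nW h1 L2
    · intro y
      rw [VE]
      constructor
      · rintro (h | h | h | h)
        · rw [Sym2.eq_iff] at h; grind
        · rw [Sym2.eq_iff] at h; grind
        · exact Or.inl h
        · have := (suppR _ _ h).1; grind
      · rintro (h | rfl)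
        · exact Or.inr (Or.inr (Or.inl h))
        · exact Or.inl rfl
    · exact fun y hy => F1 y (suppL _ _ hy).2.1
    · exact fun y hy => F3 y (suppL _ _ hy).2.1
    · intro h
      have := h.2.1
      simpa only [true_and, not_or] using this
  · refine root_step (c := c) (k := k) (l := rb) ?_ ?_ ?_ (F4 b (Or.inr (Or.inl rfl))) ?_ nsc nW h2 R3
    · intro y
      rw [VE]
      constructor
      · rintro (h | h | h | h)
        · rw [Sym2.eq_iff] at h; grind
        · rw [Sym2.eq_iff] at h; grind
        · have := (suppL _ _ h).1; grind
        · exact Or.inl h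
      · rintro (h | rfl)
        · exact Or.inr (Or.inr (Or.inr h))
        · exact Or.inr (Or.inl Sym2.eq_swap)
    · exact fun y hy => F2 y (suppR _ _ hy).2.1
    · exact fun y hy => F4 y (suppR _ _ hy).2.1
    · intro h
      have := h.2.2.1
      simpa only [true_and, not_or] using this

/-- The profile `v` is realised by the tree `t`. -/
def Realz (a b : ℕ) (t : Tr) (v : List Entry) : Prop :=
  ∀ e ∈ v, ∃ S ⊆ In t, Feas a b t S e.1 e.2.1 ∧
    6 * S.card + e.2.2 ≤ (In t).card + (D2 t).card

lemma leaf_D : ∀ e ∈ leafVec, e.1 ≠ .D ∧ e.2.1 ≠ .D ∧ e.2.2 = 0 := by decide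

lemma realz_leaf (a b : ℕ) : Realz a b .leaf leafVec := by
  intro e he
  obtain ⟨h1, h2, h3⟩ := leaf_D e he
  refine ⟨∅, by simp, ?_, by simp [h3]⟩
  refine ⟨by simp [In], ⟨fun h => absurd h h1, ?_, ?_⟩, ⟨fun h => absurd h h2, ?_, ?_⟩⟩ <;>
    simp [Ed]

lemma realz_node {a b c dec : ℕ} {l r : Tr} {p q v : List Entry}
    (hw : WF (.node c l r) a b) (hp : Realz a c l p) (hq : Realz c b r q)
    (hdec : (D2 l).card + (D2 r).card + dec ≤ (D2 (.node c l r)).card + 1)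
    (hv : ∀ e ∈ v, okEntry p q dec e = true) : Realz a b (.node c l r) v := by
  intro e he
  have := hv e he
  simp only [okEntry, List.any_eq_true, List.mem_filter, Bool.and_eq_true, Nat.ble_eq] at this
  obtain ⟨k, -, x, ⟨hx, o1⟩, y, ⟨hy, o2⟩, o3, hc⟩ := this
  obtain ⟨SL, hSL, FL, cL⟩ := hp x hx
  obtain ⟨SR, hSR, FR, cR⟩ := hq y hy
  refine ⟨_, ?_, comb hw hSL hSR FL FR o1 o2 o3, ?_⟩
  · simp only [In]
    split_ifs
    · intro z; have := @hSL z; have := @hSR z; simp; tauto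
    · intro z; have := @hSL z; have := @hSR z; simp; tauto
  · simp only [WF] at hw
    obtain ⟨hab, hac, hcb, hal, har, hbl, hbr, hcl, hcr, hd, wl, wr⟩ := hw
    have e1 : (In (.node c l r)).card = (In l).card + (In r).card + 1 := by
      simp only [In]
      rw [Finset.card_insert_of_notMem (by simp [hcl, hcr]), Finset.card_union_of_disjoint hd]
    have e2 : 6 * (SL ∪ SR ∪ if k = .S then {c} else ∅).card ≤
        6 * SL.card + 6 * SR.card + kcost k := by
      have b1 := Finset.card_union_le (SL ∪ SR) (if k = .S then {c} else ∅)
      have b2 := Finset.card_union_le SL SR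
      cases k <;> simp [kcost] at b1 ⊢ <;> omega
    omega

lemma d2_card {a b c : ℕ} {l r : Tr} (hw : WF (.node c l r) a b)
    (h : ¬ (l = .leaf ∧ r = .leaf)) :
    (D2 l).card + (D2 r).card + 1 ≤ (D2 (.node c l r)).card + 1 := by
  simp only [WF] at hw
  obtain ⟨hab, hac, hcb, hal, har, hbl, hbr, hcl, hcr, hd, wl, wr⟩ := hw
  rw [d2_node h, Finset.card_union_of_disjoint
    (Finset.disjoint_of_subset_left (d2_sub l) (Finset.disjoint_of_subset_right (d2_sub r) hd))]

lemma okPair_spec {p q : List Entry} {dec : ℕ} (h : okPair p q dec = true) :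
    ∃ v ∈ Vecs, ∀ e ∈ v, okEntry p q dec e = true := by
  simpa only [okPair, List.any_eq_true, List.all_eq_true] using h

lemma realz_all (t : Tr) : ∀ a b, WF t a b → t ≠ .leaf → ∃ v ∈ Vecs, Realz a b t v := by
  induction t with
  | leaf => intro a b _ h; exact absurd rfl h
  | node c l r ihl ihr =>
    intro a b hw _
    have hwl : WF l a c := by simp only [WF] at hw; tauto
    have hwr : WF r c b := by simp only [WF] at hw; tauto
    by_cases hl : l = .leaf
    · by_cases hr : r = .leaf
      · subst hl hr
        obtain ⟨v, hv, h⟩ := okPair_spec check_ll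
        exact ⟨v, hv, realz_node hw (realz_leaf _ _) (realz_leaf _ _) (by simp [D2]) h⟩
      · subst hl
        obtain ⟨q, hq, hq'⟩ := ihr c b hwr hr
        obtain ⟨v, hv, h⟩ := okPair_spec (List.all_eq_true.1 check_lv q hq)
        exact ⟨v, hv, realz_node hw (realz_leaf _ _) hq' (d2_card hw (by tauto)) h⟩
    · obtain ⟨p, hp, hp'⟩ := ihl a c hwl hl
      by_cases hr : r = .leaf
      · subst hr
        obtain ⟨v, hv, h⟩ := okPair_spec (List.all_eq_true.1 check_vl p hp)
        exact ⟨v, hv, realz_node hw hp' (realz_leaf _ _) (d2_card hw (by tauto)) h⟩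
      · obtain ⟨q, hq, hq'⟩ := ihr c b hwr hr
        obtain ⟨v, hv, h⟩ := okPair_spec
          (List.all_eq_true.1 (List.all_eq_true.1 check_vv p hp) q hq)
        exact ⟨v, hv, realz_node hw hp' hq' (d2_card hw (by tauto)) h⟩

lemma okF_I {p q op oq : St} (h : okF p q op oq = true) : p = .I ↔ q = .I := by
  cases p <;> cases q <;> simp_all [okF]

lemma okF_PD {p q op oq : St} (h : okF p q op oq = true)
    (h' : p = .P ∨ p = .D ∨ q = .P ∨ q = .D) : op = .I ∨ p = .D ∨ q = .D := by
  cases p <;> cases q <;> simp_all [okF]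

lemma okF_U {p q op oq : St} (h : okF p q op oq = true) (h1 : isU p = true) :
    (p = .U0 ∧ q = .U0) ∨ (¬ (isU op = true ∧ isU oq = true) ∧
      ((p = .U1 ∧ q = .U0) ∨ (p = .U0 ∧ q = .U1))) := by
  cases p <;> cases q <;> simp_all [okF, isU] <;> tauto

/-- Condition at a root of the final gluing. -/
lemma fin_root {E1 E2 E n1 n2 u1 u2 u : ℕ → Prop} {x o : ℕ} {p q op oq : St}
    (hE : ∀ y, E y ↔ y = o ∨ E1 y ∨ E2 y)
    (hu1 : ∀ y, E1 y → u y → u1 y) (hu2 : ∀ y, E2 y → u y → u2 y)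
    (hx1 : u x → u1 x) (hx2 : u x → u2 x) (hx : u x → isU p = true)
    (ho : u o → isU op = true ∧ isU oq = true)
    (h : okF p q op oq = true) (R1 : RootOK E1 n1 u1 x p) (R2 : RootOK E2 n2 u2 x q) :
    u x → ∀ y z, E y → E z → u y → u z → y = z := by
  intro hux y z hy hz huy huz
  have a1 := hu1 y
  have a2 := hu1 z
  have a3 := hu2 y
  have a4 := hu2 z
  have b1 := (hE y).1 hy
  have b2 := (hE z).1 hz
  rcases okF_U h (hx hux) with ⟨h1, h2⟩ | ⟨h0, ⟨h1, h2⟩ | ⟨h1, h2⟩⟩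
  · have c1 := R1.2.1 h1 (hx1 hux) y
    have c2 := R1.2.1 h1 (hx1 hux) z
    have c3 := R2.2.1 h2 (hx2 hux) y
    have c4 := R2.2.1 h2 (hx2 hux) z
    grind
  · have c1 := R1.2.2 h1 (hx1 hux) y z
    have c3 := R2.2.1 h2 (hx2 hux) y
    have c4 := R2.2.1 h2 (hx2 hux) z
    grind
  · have c1 := R2.2.2 h2 (hx2 hux) y z
    have c3 := R1.2.1 h1 (hx1 hux) y
    have c4 := R1.2.1 h1 (hx1 hux) z
    grind

set_option maxHeartbeats 1000000 in
lemma glue {G : SimpleGraph ℕ} {a b : ℕ} {t₁ t₂ : Tr} {S1 S2 : Finset ℕ} {pa pb qa qb : St}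
    (w1 : WF t₁ a b) (w2 : WF t₂ a b) (hd : Disjoint (In t₁) (In t₂))
    (hA : ∀ x y, G.Adj x y ↔ s(x, y) = s(a, b) ∨ s(x, y) ∈ Ed t₁ a b ∨ s(x, y) ∈ Ed t₂ a b)
    (hS1 : S1 ⊆ In t₁) (hS2 : S2 ⊆ In t₂)
    (f1 : Feas a b t₁ S1 pa pb) (f2 : Feas a b t₂ S2 qa qb)
    (ha : okF pa qa pb qb = true) (hb : okF pb qb pa qa = true) :
    ∃ S : Finset ℕ, IsIsolating12 G (insert a (insert b (In t₁ ∪ In t₂))) S ∧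
      6 * S.card ≤ 6 * S1.card + 6 * S2.card + rcost pa + rcost pb := by
  rw [Finset.disjoint_left] at hd
  let Sa : Finset ℕ := if pa = .I then {a} else ∅
  let Sb : Finset ℕ := if pb = .I then {b} else ∅
  obtain ⟨S, hS⟩ : ∃ S, S = S1 ∪ S2 ∪ (Sa ∪ Sb) := ⟨_, rfl⟩
  have memA : ∀ x, x ∈ Sa ↔ x = a ∧ pa = .I := by
    intro x; simp only [Sa]; split_ifs with h <;> simp [h]
  have memB : ∀ x, x ∈ Sb ↔ x = b ∧ pb = .I := by
    intro x; simp only [Sb]; split_ifs with h <;> simp [h]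
  have memS : ∀ x, x ∈ S ↔ x ∈ S1 ∨ x ∈ S2 ∨ (x = a ∧ pa = .I) ∨ (x = b ∧ pb = .I) := by
    intro x; rw [hS]; simp only [Finset.mem_union, memA, memB, or_assoc]
  have hab := w1.ne
  obtain ⟨a1, b1⟩ := w1.notMem
  obtain ⟨a2, b2⟩ := w2.notMem
  have ia := okF_I ha
  have ib := okF_I hb
  have sup1 := fun x y => @ed_supp t₁ a b x y w1
  have sup2 := fun x y => @ed_supp t₂ a b x y w2
  have N1 : ∀ x, (x = a ∨ x = b ∨ x ∈ In t₁) → NS a b S1 pa pb x → x ∈ S := by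
    intro x _ h
    rw [memS]; rcases h with h | h
    · exact Or.inl h
    · exact Or.inr (Or.inr h)
  have N2 : ∀ x, (x = a ∨ x = b ∨ x ∈ In t₂) → NS a b S2 qa qb x → x ∈ S := by
    intro x _ h
    rw [NS, ← ia, ← ib] at h
    rw [memS]; rcases h with h | h
    · exact Or.inr (Or.inl h)
    · exact Or.inr (Or.inr h)
  obtain ⟨u, hu⟩ : ∃ u : ℕ → Prop, ∀ x, u x ↔ x ∉ closedNbhd G S := ⟨_, fun _ => Iff.rfl⟩
  have uS : ∀ x, u x → x ∉ S := fun x h h' => (hu x).1 h (Or.inl h')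
  have uN : ∀ x, u x → ∀ y, G.Adj x y → y ∉ S := fun x h y hy h' =>
    (hu x).1 h (Or.inr ⟨y, h', hy.symm⟩)
  have A1 : ∀ x y, s(x, y) ∈ Ed t₁ a b → G.Adj x y := fun x y h => (hA x y).2 (Or.inr (Or.inl h))
  have A2 : ∀ x y, s(x, y) ∈ Ed t₂ a b → G.Adj x y := fun x y h => (hA x y).2 (Or.inr (Or.inr h))
  have Aab : G.Adj a b := (hA a b).2 (Or.inl rfl)
  obtain ⟨I1, ra1, rb1⟩ := f1
  obtain ⟨I2, ra2, rb2⟩ := f2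
  have aI : pa = .I → a ∈ S := fun h => (memS a).2 (Or.inr (Or.inr (Or.inl ⟨rfl, h⟩)))
  have bI : pb = .I → b ∈ S := fun h => (memS b).2 (Or.inr (Or.inr (Or.inr ⟨rfl, h⟩)))
  have ua : u a → ¬ (pa = .P ∨ pa = .D ∨ qa = .P ∨ qa = .D) := by
    intro h h'
    rcases okF_PD ha h' with h' | h' | h'
    · exact uN a h b Aab (bI h')
    · obtain ⟨y, hy, hy'⟩ := ra1.1 h'
      exact uN a h y (A1 _ _ hy) (N1 y (sup1 _ _ hy).2.1 hy')
    · obtain ⟨y, hy, hy'⟩ := ra2.1 h'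
      exact uN a h y (A2 _ _ hy) (N2 y (sup2 _ _ hy).2.1 hy')
  have ub : u b → ¬ (pb = .P ∨ pb = .D ∨ qb = .P ∨ qb = .D) := by
    intro h h'
    rcases okF_PD hb h' with h' | h' | h'
    · exact uN b h a Aab.symm (aI h')
    · obtain ⟨y, hy, hy'⟩ := rb1.1 h'
      exact uN b h y (A1 _ _ hy) (N1 y (sup1 _ _ hy).2.1 hy')
    · obtain ⟨y, hy, hy'⟩ := rb2.1 h'
      exact uN b h y (A2 _ _ hy) (N2 y (sup2 _ _ hy).2.1 hy')
  simp only [not_or] at ua ub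
  have U1 : ∀ x, (x = a ∨ x = b ∨ x ∈ In t₁) → u x → Un a b t₁ S1 pa pb x := by
    intro x hx h
    refine ⟨fun h' => uS x h (N1 x hx h'), ?_, ?_, ?_⟩
    · rintro ⟨rfl, h'⟩
      exact h'.elim (ua h).1 (ua h).2.1
    · rintro ⟨rfl, h'⟩
      exact h'.elim (ub h).1 (ub h).2.1
    · intro y hy hn
      exact uN x h y (A1 _ _ hy) (N1 y (sup1 _ _ hy).2.1 hn)
  have U2 : ∀ x, (x = a ∨ x = b ∨ x ∈ In t₂) → u x → Un a b t₂ S2 qa qb x := by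
    intro x hx h
    refine ⟨fun h' => uS x h (N2 x hx h'), ?_, ?_, ?_⟩
    · rintro ⟨rfl, h'⟩
      exact h'.elim (ua h).2.2.1 (ua h).2.2.2
    · rintro ⟨rfl, h'⟩
      exact h'.elim (ub h).2.2.1 (ub h).2.2.2
    · intro y hy hn
      exact uN x h y (A2 _ _ hy) (N2 y (sup2 _ _ hy).2.1 hn)
  have va : u a → isU pa = true ∧ isU qa = true := fun h =>
    ⟨isU_of ⟨(ua h).1, (ua h).2.1⟩ (fun h' => uS a h (aI h')),
      isU_of ⟨(ua h).2.2.1, (ua h).2.2.2⟩ (fun h' => uS a h (aI (ia.2 h')))⟩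
  have vb : u b → isU pb = true ∧ isU qb = true := fun h =>
    ⟨isU_of ⟨(ub h).1, (ub h).2.1⟩ (fun h' => uS b h (bI h')),
      isU_of ⟨(ub h).2.2.1, (ub h).2.2.2⟩ (fun h' => uS b h (bI (ib.2 h')))⟩
  have Ka : u a → ∀ y z, G.Adj a y → G.Adj a z → u y → u z → y = z := by
    refine fin_root (o := b) ?_ ?_ ?_ (U1 a (Or.inl rfl)) (U2 a (Or.inl rfl))
      (fun h => (va h).1) vb ha ra1 ra2
    · intro y
      rw [hA]
      have : s(a, y) = s(a, b) ↔ y = b := by rw [Sym2.eq_iff]; grind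
      rw [this]
    · exact fun y hy => U1 y (sup1 _ _ hy).2.1
    · exact fun y hy => U2 y (sup2 _ _ hy).2.1
  have Kb : u b → ∀ y z, G.Adj b y → G.Adj b z → u y → u z → y = z := by
    refine fin_root (o := a) ?_ ?_ ?_ (U1 b (Or.inr (Or.inl rfl))) (U2 b (Or.inr (Or.inl rfl)))
      (fun h => (vb h).1) va hb rb1 rb2
    · intro y
      rw [hA]
      have : s(b, y) = s(a, b) ↔ y = a := by rw [Sym2.eq_iff]; grind
      rw [this]
    · exact fun y hy => U1 y (sup1 _ _ hy).2.1
    · exact fun y hy => U2 y (sup2 _ _ hy).2.1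
  refine ⟨S, ⟨?_, ?_⟩, ?_⟩
  · intro x hx
    simp only [Finset.mem_insert, Finset.mem_union]
    rcases (memS x).1 hx with h | h | h | h
    · exact Or.inr (Or.inr (Or.inl (hS1 h)))
    · exact Or.inr (Or.inr (Or.inr (hS2 h)))
    · exact Or.inl h.1
    · exact Or.inr (Or.inl h.1)
  · intro x y z hx _ _ hux huy huz hxy hxz
    rw [← hu] at hux huy huz
    simp only [Finset.mem_insert, Finset.mem_union] at hx
    rcases hx with rfl | rfl | hx | hx
    · exact Ka hux y z hxy hxz huy huz
    · exact Kb hux y z hxy hxz huy huz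
    · have key : ∀ y, G.Adj x y → s(x, y) ∈ Ed t₁ a b := by
        intro y hy
        rcases (hA x y).1 hy with h | h | h
        · rw [Sym2.eq_iff] at h; exfalso; grind
        · exact h
        · have := (sup2 _ _ h).1; exfalso; grind
      have hy' := key y hxy
      have hz' := key z hxz
      exact I1 x hx (U1 x (Or.inr (Or.inr hx)) hux) y z hy' hz' (U1 y (sup1 _ _ hy').2.1 huy)
        (U1 z (sup1 _ _ hz').2.1 huz)
    · have key : ∀ y, G.Adj x y → s(x, y) ∈ Ed t₂ a b := by
        intro y hy
        rcases (hA x y).1 hy with h | h | h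
        · rw [Sym2.eq_iff] at h; exfalso; grind
        · have := (sup1 _ _ h).1; exfalso; grind
        · exact h
      have hy' := key y hxy
      have hz' := key z hxz
      exact I2 x hx (U2 x (Or.inr (Or.inr hx)) hux) y z hy' hz' (U2 y (sup2 _ _ hy').2.1 huy)
        (U2 z (sup2 _ _ hz').2.1 huz)
  · have c1 := Finset.card_union_le (S1 ∪ S2) (Sa ∪ Sb)
    have c2 := Finset.card_union_le S1 S2
    have c3 := Finset.card_union_le Sa Sb
    have c4 : 6 * Sa.card ≤ rcost pa := by simp only [Sa]; cases pa <;> simp [rcost]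
    have c5 : 6 * Sb.card ≤ rcost pb := by simp only [Sb]; cases pb <;> simp [rcost]
    rw [← hS] at c1
    omega

lemma deg_two {G : SimpleGraph ℕ} {x p q : ℕ} (hpq : p ≠ q)
    (h : ∀ y, G.Adj x y ↔ y = p ∨ y = q) : degOf G x = 2 := by
  have : G.neighborSet x = {p, q} := by
    ext y; simp [SimpleGraph.mem_neighborSet, h]
  rw [degOf, this, Set.ncard_pair hpq]

lemma rep_bound {G : SimpleGraph ℕ} {V : Finset ℕ} {C : Finset (Sym2 ℕ)} (h : Rep G V C) :
    6 * iota1 G V ≤ V.card + numDeg2 G V := by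
  obtain ⟨a, b, t₁, t₂, w1, w2, hd, n1, n2, hV, hA, -⟩ := h
  obtain ⟨v1, hv1, r1⟩ := realz_all t₁ a b w1 n1
  obtain ⟨v2, hv2, r2⟩ := realz_all t₂ a b w2 n2
  have hf := List.all_eq_true.1 (List.all_eq_true.1 check_fin v1 hv1) v2 hv2
  simp only [okFin, List.any_eq_true, Bool.and_eq_true, Nat.ble_eq] at hf
  obtain ⟨x, hx, y, hy, ⟨o1, o2⟩, o3⟩ := hf
  obtain ⟨S1, hS1, f1, c1⟩ := r1 x hx
  obtain ⟨S2, hS2, f2, c2⟩ := r2 y hy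
  obtain ⟨S, hS, hc⟩ := glue w1 w2 hd hA hS1 hS2 f1 f2 o1 o2
  rw [← hV] at hS
  have hab := w1.ne
  obtain ⟨a1, b1⟩ := w1.notMem
  obtain ⟨a2, b2⟩ := w2.notMem
  have e1 : iota1 G V ≤ S.card := Nat.sInf_le ⟨S, hS, rfl⟩
  have e2 : V.card = (In t₁).card + (In t₂).card + 2 := by
    rw [hV, Finset.card_insert_of_notMem (by simp [hab, a1, a2]),
      Finset.card_insert_of_notMem (by simp [b1, b2]), Finset.card_union_of_disjoint hd]
  have hd' := hd
  rw [Finset.disjoint_left] at hd'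
  have e3 : (D2 t₁).card + (D2 t₂).card ≤ numDeg2 G V := by
    rw [← Finset.card_union_of_disjoint (Finset.disjoint_of_subset_left (d2_sub t₁)
      (Finset.disjoint_of_subset_right (d2_sub t₂) hd)), ← Set.ncard_coe_finset, numDeg2]
    refine Set.ncard_le_ncard ?_ (Set.Finite.subset V.finite_toSet (fun z hz => hz.1))
    intro z hz
    simp only [Finset.coe_union, Set.mem_union, Finset.mem_coe] at hz
    rcases hz with hz | hz
    · have hi := d2_sub _ hz
      refine ⟨by rw [hV]; simp [hi], ?_⟩
      obtain ⟨p, q, hpq, H⟩ := d2_deg w1 hz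
      refine deg_two hpq (fun y => ?_)
      rw [← H, hA]
      constructor
      · rintro (h | h | h)
        · rw [Sym2.eq_iff] at h; exfalso; grind
        · exact h
        · have := (ed_supp w2 h).1; exfalso; grind
      · exact fun h => Or.inr (Or.inl h)
    · have hi := d2_sub _ hz
      refine ⟨by rw [hV]; simp [hi], ?_⟩
      obtain ⟨p, q, hpq, H⟩ := d2_deg w2 hz
      refine deg_two hpq (fun y => ?_)
      rw [← H, hA]
      constructor
      · rintro (h | h | h)
        · rw [Sym2.eq_iff] at h; exfalso; grind
        · have := (ed_supp w1 h).1; exfalso; grind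
        · exact h
      · exact fun h => Or.inr (Or.inr h)
  omega

end MopProof

/-- **Theorem 3, first case.** If `G` is a mop of order `n ≥ 5` with `n₂` vertices of
degree `2` and `n₂ ≤ n / 3`, then `ι₁(G) ≤ (n + n₂) / 6`. -/
theorem mop_iota1_le_of_numDeg2_le (G : SimpleGraph ℕ) (V : Finset ℕ)
    (hG : IsMop G V) (hn : 5 ≤ V.card)
    (hn2 : (numDeg2 G V : ℚ) ≤ (V.card : ℚ) / 3) :
    (iota1 G V : ℚ) ≤ ((V.card : ℚ) + (numDeg2 G V : ℚ)) / 6 := by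
  obtain ⟨C, hC⟩ := hG
  rcases MopProof.rep_or_tri hC with ⟨h, -⟩ | h
  · omega
  · have := MopProof.rep_bound h
    have h' : (6 * iota1 G V : ℚ) ≤ V.card + numDeg2 G V := by exact_mod_cast this
    linarith
end

section
/- If G is a maximal outerplanar graph of order n ≥ 5, n₂ denotes the number of vertices of G of degree 2, and n₂ > n/3, then the K_{1,2}-isolation number of G satisfies ι₁(G) ≤ (n − n₂)/3. -/
open SimpleGraph

/-- A vertex with at least three distinct neighbours. -/
def T3 (G : SimpleGraph ℕ) (v : ℕ) : Prop :=
  ∃ a b c, a ≠ b ∧ a ≠ c ∧ b ≠ c ∧ G.Adj v a ∧ G.Adj v b ∧ G.Adj v c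

/-- Basic invariant of mops. -/
structure MopInv (G : SimpleGraph ℕ) (V : Finset ℕ) (C : Finset (Sym2 ℕ)) : Prop where
  mem : ∀ x y, G.Adj x y → x ∈ V ∧ y ∈ V
  cyc : ∀ x y, s(x, y) ∈ C → G.Adj x y
  col : ∃ c : ℕ → Fin 3, ∀ x y, G.Adj x y → c x ≠ c y
  tri : ∀ x ∈ V, ∃ a b, G.Adj x a ∧ G.Adj x b ∧ G.Adj a b
  card : 3 ≤ V.card
  three : V.card = 3 → (∀ x ∈ V, ∀ y ∈ V, x ≠ y → G.Adj x y)
  indep : 4 ≤ V.card → ∀ x y, G.Adj x y → T3 G x ∨ T3 G y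
  four : 4 ≤ V.card →
    (∀ y, T3 G y → ∃ a b, T3 G a ∧ T3 G b ∧ G.Adj y a ∧ G.Adj y b ∧ G.Adj a b) ∨
    (V.card = 4 ∧ ∃ p q, (∀ y, T3 G y ↔ (y = p ∨ y = q)) ∧ G.Adj p q ∧ s(p, q) ∉ C ∧
      ∀ z ∈ V, z ≠ p → z ≠ q → G.Adj z p ∧ G.Adj z q)

theorem T3.four_le {G : SimpleGraph ℕ} {V : Finset ℕ} (hm : ∀ x y, G.Adj x y → x ∈ V ∧ y ∈ V)
    {v : ℕ} (h : T3 G v) : 4 ≤ V.card := by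
  obtain ⟨a, b, c, hab, hac, hbc, ha, hb, hc⟩ := h
  have hsub : ({v, a, b, c} : Finset ℕ) ⊆ V := by
    intro x hx
    simp only [Finset.mem_insert, Finset.mem_singleton] at hx
    rcases hx with rfl | rfl | rfl | rfl
    · exact (hm _ _ ha).1
    · exact (hm _ _ ha).2
    · exact (hm _ _ hb).2
    · exact (hm _ _ hc).2
  have := Finset.card_le_card hsub
  have h4 : ({v, a, b, c} : Finset ℕ).card = 4 := by
    have := ha.ne; have := hb.ne; have := hc.ne
    rw [Finset.card_insert_of_notMem, Finset.card_insert_of_notMem,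
      Finset.card_insert_of_notMem, Finset.card_singleton] <;> simp <;> tauto
  omega

theorem exists_third (i j : Fin 3) : ∃ k : Fin 3, k ≠ i ∧ k ≠ j := by
  revert i j; decide

theorem inv_triangle (a b c : ℕ) (hab : a ≠ b) (hac : a ≠ c) (hbc : b ≠ c) :
    MopInv (SimpleGraph.fromEdgeSet {s(a, b), s(b, c), s(a, c)})
        {a, b, c} {s(a, b), s(b, c), s(a, c)} := by
  have hadj : ∀ x y, (SimpleGraph.fromEdgeSet {s(a, b), s(b, c), s(a, c)}).Adj x y ↔
      (x ∈ ({a, b, c} : Finset ℕ) ∧ y ∈ ({a, b, c} : Finset ℕ) ∧ x ≠ y) := by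
    intro x y
    simp only [SimpleGraph.fromEdgeSet_adj, Set.mem_insert_iff, Set.mem_singleton_iff, Sym2.eq_iff,
      Finset.mem_insert, Finset.mem_singleton]
    constructor
    · rintro ⟨h, h'⟩
      refine ⟨?_, ?_, h'⟩ <;> tauto
    · grind
  have hcard : ({a, b, c} : Finset ℕ).card = 3 := by
    rw [Finset.card_eq_three]; exact ⟨a, b, c, hab, hac, hbc, rfl⟩
  refine ⟨?_, ?_, ?_, ?_, hcard.ge, ?_, ?_, ?_⟩
  · intro x y h; rw [hadj] at h; exact ⟨h.1, h.2.1⟩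
  · intro x y h
    rw [hadj]
    simp only [Finset.mem_insert, Finset.mem_singleton, Sym2.eq_iff] at h ⊢
    grind
  · refine ⟨fun x => if x = a then 0 else if x = b then 1 else 2, ?_⟩
    intro x y h
    rw [hadj] at h
    simp only [Finset.mem_insert, Finset.mem_singleton] at h
    grind
  · intro x hx
    simp only [hadj]
    simp only [Finset.mem_insert, Finset.mem_singleton] at hx ⊢
    rcases hx with rfl | rfl | rfl
    · exact ⟨b, c, by grind⟩
    · exact ⟨a, c, by grind⟩
    · exact ⟨a, b, by grind⟩
  · intro _ x hx y hy hxy; rw [hadj]; exact ⟨hx, hy, hxy⟩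
  · intro h; omega
  · intro h; omega

set_option maxHeartbeats 2000000 in
theorem inv_grow (G : SimpleGraph ℕ) (V : Finset ℕ) (C : Finset (Sym2 ℕ)) (u v w : ℕ)
    (h : MopInv G V C) (huv : s(u, v) ∈ C) (hw : w ∉ V) :
    MopInv (SimpleGraph.fromEdgeSet (insert s(u, w) (insert s(v, w) G.edgeSet)))
        (insert w V) (insert s(u, w) (insert s(v, w) (C.erase s(u, v)))) := by
  have huvA := h.cyc _ _ huv
  obtain ⟨hu, hv⟩ := h.mem _ _ huvA
  have huw : u ≠ w := fun e => hw (e ▸ hu)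
  have hvw : v ≠ w := fun e => hw (e ▸ hv)
  have huv' := huvA.ne
  set G' := SimpleGraph.fromEdgeSet (insert s(u, w) (insert s(v, w) G.edgeSet)) with hG'
  have hadj : ∀ x y, G'.Adj x y ↔
      (G.Adj x y ∨ (x = w ∧ (y = u ∨ y = v)) ∨ (y = w ∧ (x = u ∨ x = v))) := by
    intro x y
    simp only [hG', SimpleGraph.fromEdgeSet_adj, Set.mem_insert_iff, Sym2.eq_iff,
      SimpleGraph.mem_edgeSet]
    have := fun h : G.Adj x y => h.ne
    grind
  clear_value G'
  have hmono : ∀ x y, G.Adj x y → G'.Adj x y := fun x y hh => (hadj x y).2 (Or.inl hh)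
  have hTmono : ∀ x, T3 G x → T3 G' x := by
    rintro x ⟨a, b, c, hab, hac, hbc, ha, hb, hc⟩
    exact ⟨a, b, c, hab, hac, hbc, hmono _ _ ha, hmono _ _ hb, hmono _ _ hc⟩
  have hTuv : ∀ x, (x = u ∨ x = v) → T3 G' x := by
    intro x hx
    have hxV : x ∈ V := by rcases hx with rfl | rfl <;> assumption
    obtain ⟨a, b, ha, hb, hab⟩ := h.tri x hxV
    refine ⟨a, b, w, hab.ne, ?_, ?_, hmono _ _ ha, hmono _ _ hb, (hadj _ _).2 (Or.inr (Or.inr ⟨rfl, hx⟩))⟩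
    · rintro rfl; exact hw (h.mem _ _ ha).2
    · rintro rfl; exact hw (h.mem _ _ hb).2
  have hTu := hTuv u (Or.inl rfl)
  have hTv := hTuv v (Or.inr rfl)
  have hwn : ∀ x, ¬ G.Adj w x := fun x hh => hw (h.mem _ _ hh).1
  have hT' : ∀ x, T3 G' x → T3 G x ∨ x = u ∨ x = v := by
    rintro x ⟨a, b, c, hab, hac, hbc, ha, hb, hc⟩
    by_cases hx : x = u ∨ x = v
    · exact Or.inr hx
    left
    rw [hadj] at ha hb hc
    by_cases hxw : x = w
    · subst hxw
      have := hwn a; have := hwn b; have := hwn c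
      grind
    · exact ⟨a, b, c, hab, hac, hbc, by tauto, by tauto, by tauto⟩
  have hcard : (insert w V).card = V.card + 1 := Finset.card_insert_of_notMem hw
  have hc3 := h.card
  have hindep : ∀ x y, G'.Adj x y → T3 G' x ∨ T3 G' y := by
    intro x y hxy
    rw [hadj] at hxy
    rcases hxy with hxy | ⟨-, hy⟩ | ⟨-, hx⟩
    · by_cases h4 : 4 ≤ V.card
      · exact (h.indep h4 x y hxy).imp (hTmono x) (hTmono y)
      · by_contra hcon
        rw [not_or] at hcon
        have hsub : ({x, y, u, v} : Finset ℕ) ⊆ V := by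
          intro z hz
          simp only [Finset.mem_insert, Finset.mem_singleton] at hz
          have := h.mem _ _ hxy
          rcases hz with rfl | rfl | rfl | rfl <;> tauto
        have hle := Finset.card_le_card hsub
        have h4' : ({x, y, u, v} : Finset ℕ).card = 4 := by
          have := hxy.ne
          have : x ≠ u := by rintro rfl; tauto
          have : x ≠ v := by rintro rfl; tauto
          have : y ≠ u := by rintro rfl; tauto
          have : y ≠ v := by rintro rfl; tauto
          rw [Finset.card_insert_of_notMem, Finset.card_insert_of_notMem,
            Finset.card_insert_of_notMem, Finset.card_singleton] <;> simp <;> tauto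
        omega
    · exact Or.inr (hTuv y hy)
    · exact Or.inl (hTuv x hx)
  refine ⟨?_, ?_, ?_, ?_, by omega, by omega, fun _ => hindep, ?_⟩
  · intro x y hxy
    rw [hadj] at hxy
    have := h.mem x y
    simp only [Finset.mem_insert]
    rcases hxy with hxy | ⟨rfl, rfl | rfl⟩ | ⟨rfl, rfl | rfl⟩ <;> tauto
  · intro x y hxy
    rw [hadj]
    have := h.cyc x y
    simp only [Finset.mem_insert, Sym2.eq_iff, Finset.mem_erase] at hxy
    tauto
  · obtain ⟨c, hc⟩ := h.col
    obtain ⟨k, hk1, hk2⟩ := exists_third (c u) (c v)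
    refine ⟨fun x => if x = w then k else c x, ?_⟩
    intro x y hxy
    rw [hadj] at hxy
    rcases hxy with hxy | ⟨rfl, rfl | rfl⟩ | ⟨rfl, rfl | rfl⟩
    · have h1 : x ≠ w := fun e => hw (e ▸ (h.mem _ _ hxy).1)
      have h2 : y ≠ w := fun e => hw (e ▸ (h.mem _ _ hxy).2)
      simpa [h1, h2] using hc x y hxy
    · simpa [huw] using hk1
    · simpa [hvw] using hk2
    · simpa [huw] using hk1.symm
    · simpa [hvw] using hk2.symm
  · intro x hx
    rw [Finset.mem_insert] at hx
    rcases hx with rfl | hx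
    · exact ⟨u, v, by rw [hadj]; tauto, by rw [hadj]; tauto, hmono _ _ huvA⟩
    · obtain ⟨a, b, ha, hb, hab⟩ := h.tri x hx
      exact ⟨a, b, hmono _ _ ha, hmono _ _ hb, hmono _ _ hab⟩
  · intro _
    by_cases h4 : 4 ≤ V.card
    · left
      rcases h.four h4 with h5 | ⟨-, p, q, hpq, hA, hC, hz⟩
      · -- a vertex of the cycle edge that was not of large degree
        have key : ∀ x ∈ V, ∃ a b, T3 G' a ∧ T3 G' b ∧ G'.Adj x a ∧ G'.Adj x b ∧ G'.Adj a b := by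
          intro x hx
          by_cases hT : T3 G x
          · obtain ⟨a, b, h1, h2, h3, h4, h5⟩ := h5 x hT
            exact ⟨a, b, hTmono _ h1, hTmono _ h2, hmono _ _ h3, hmono _ _ h4, hmono _ _ h5⟩
          · obtain ⟨a, b, ha, hb, hab⟩ := h.tri x hx
            exact ⟨a, b, hTmono _ ((h.indep h4 _ _ ha).resolve_left hT),
              hTmono _ ((h.indep h4 _ _ hb).resolve_left hT),
              hmono _ _ ha, hmono _ _ hb, hmono _ _ hab⟩
        intro y hy
        apply key
        rcases hT' y hy with ⟨a, -, -, -, -, -, ha, -, -⟩ | rfl | rfl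
        · exact (h.mem _ _ ha).1
        · exact hu
        · exact hv
      · have hTp : T3 G' p := hTmono _ ((hpq p).2 (Or.inl rfl))
        have hTq : T3 G' q := hTmono _ ((hpq q).2 (Or.inr rfl))
        have key : ∀ z ∈ V, T3 G' z → z ≠ p → z ≠ q → ∀ y, (y = z ∨ y = p ∨ y = q) →
            ∃ a b, T3 G' a ∧ T3 G' b ∧ G'.Adj y a ∧ G'.Adj y b ∧ G'.Adj a b := by
          intro z hzV hTz hzp hzq y hy
          obtain ⟨h1, h2⟩ := hz z hzV hzp hzq
          have h1 := hmono _ _ h1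
          have h2 := hmono _ _ h2
          have h3 := hmono _ _ hA
          rcases hy with rfl | rfl | rfl
          · exact ⟨p, q, hTp, hTq, h1, h2, h3⟩
          · exact ⟨z, q, hTz, hTq, h1.symm, h3, h2⟩
          · exact ⟨z, p, hTz, hTp, h2.symm, h3.symm, h1⟩
        have hsome := h.indep h4 _ _ huvA
        rw [hpq, hpq] at hsome
        intro y hy
        have hy' := hT' y hy
        rw [hpq] at hy'
        by_cases hup : u = p ∨ u = q
        · have hvp : ¬ (v = p ∨ v = q) := by
            intro hvp
            rcases hup with rfl | rfl <;> rcases hvp with rfl | rfl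
            · exact huv' rfl
            · exact hC huv
            · exact hC (Sym2.eq_swap ▸ huv)
            · exact huv' rfl
          rw [not_or] at hvp
          refine key v hv hTv hvp.1 hvp.2 y ?_
          rcases hy' with hy' | rfl | rfl <;> tauto
        · rw [not_or] at hup
          refine key u hu hTu hup.1 hup.2 y ?_
          rcases hy' with hy' | rfl | rfl <;> tauto
    · right
      have h3 : V.card = 3 := by omega
      refine ⟨by omega, u, v, ?_, hmono _ _ huvA, ?_, ?_⟩
      · intro y
        refine ⟨fun hy => (hT' y hy).resolve_left fun hh => h4 (hh.four_le h.mem), hTuv y⟩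
      · simp only [Finset.mem_insert, Sym2.eq_iff, Finset.mem_erase]
        grind
      · intro z hz hzu hzv
        rw [Finset.mem_insert] at hz
        rcases hz with rfl | hz
        · exact ⟨by rw [hadj]; tauto, by rw [hadj]; tauto⟩
        · exact ⟨hmono _ _ (h.three h3 z hz u hu hzu), hmono _ _ (h.three h3 z hz v hv hzv)⟩

theorem inv_of_mop {G : SimpleGraph ℕ} {V : Finset ℕ} {C : Finset (Sym2 ℕ)}
    (h : IsMopCycle G V C) : MopInv G V C := by
  induction h with
  | triangle a b c hab hac hbc => exact inv_triangle a b c hab hac hbc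
  | grow G V C u v w _ huv hw ih => exact inv_grow G V C u v w ih huv hw

theorem degOf_eq_two_iff {G : SimpleGraph ℕ} {V : Finset ℕ} {C : Finset (Sym2 ℕ)}
    (h : MopInv G V C) {x : ℕ} (hx : x ∈ V) : degOf G x = 2 ↔ ¬ T3 G x := by
  obtain ⟨a, b, ha, hb, hab⟩ := h.tri x hx
  unfold degOf
  constructor
  · rintro h2 ⟨p, q, r, hpq, hpr, hqr, hp, hq, hr⟩
    rw [Set.ncard_eq_two] at h2
    obtain ⟨s, t, -, hst⟩ := h2
    have key : ∀ z, G.Adj x z → z = s ∨ z = t := by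
      intro z hz
      have : z ∈ G.neighborSet x := hz
      rw [hst] at this
      simpa using this
    have := key p hp; have := key q hq; have := key r hr
    grind
  · intro hT
    rw [Set.ncard_eq_two]
    refine ⟨a, b, hab.ne, ?_⟩
    ext z
    simp only [SimpleGraph.mem_neighborSet, Set.mem_insert_iff, Set.mem_singleton_iff]
    constructor
    · intro hz
      by_contra hcon
      rw [not_or] at hcon
      exact hT ⟨a, b, z, hab.ne, Ne.symm hcon.1, Ne.symm hcon.2, ha, hb, hz⟩
    · rintro (rfl | rfl) <;> assumption

/-- **Theorem 3, second case.** If `G` is a mop of order `n ≥ 5` with `n₂` vertices of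
degree `2` and `n₂ > n / 3`, then `ι₁(G) ≤ (n − n₂) / 3`. -/
theorem mop_iota1_le_of_numDeg2_gt (G : SimpleGraph ℕ) (V : Finset ℕ)
    (hG : IsMop G V) (hn : 5 ≤ V.card)
    (hn2 : (V.card : ℚ) / 3 < (numDeg2 G V : ℚ)) :
    (iota1 G V : ℚ) ≤ ((V.card : ℚ) - (numDeg2 G V : ℚ)) / 3 := by
  classical
  obtain ⟨C, hC⟩ := hG
  have h := inv_of_mop hC
  obtain ⟨c, hc⟩ := h.col
  have h4 : 4 ≤ V.card := by omega
  have htri : ∀ y, T3 G y → ∃ a b, T3 G a ∧ T3 G b ∧ G.Adj y a ∧ G.Adj y b ∧ G.Adj a b := by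
    rcases h.four h4 with h5 | ⟨h5, -⟩
    · exact h5
    · omega
  have hnum : numDeg2 G V = (V.filter fun x => ¬ T3 G x).card := by
    unfold numDeg2
    rw [← Set.ncard_coe_finset]
    congr 1
    ext x
    simp only [Set.mem_setOf_eq, Finset.coe_filter, Finset.mem_coe]
    exact and_congr_right fun hx => degOf_eq_two_iff h hx
  set W := V.filter fun x => T3 G x with hW
  have hsum : W.card + numDeg2 G V = V.card := by
    rw [hnum]; exact Finset.card_filter_add_card_filter_not _
  have hiso : ∀ i : Fin 3, IsIsolating12 G V (W.filter fun x => c x = i) := by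
    intro i
    have hdom : ∀ y, T3 G y → y ∈ closedNbhd G (W.filter fun x => c x = i) := by
      intro y hy
      obtain ⟨a, b, ha, hb, hya, hyb, hab⟩ := htri y hy
      have h1 := hc _ _ hya
      have h2 := hc _ _ hyb
      have h3 := hc _ _ hab
      have hmemW : ∀ z, z ∈ V → T3 G z → c z = i → z ∈ W.filter fun x => c x = i := by
        intro z hzV hz hzi
        simp only [hW, Finset.mem_filter]
        exact ⟨⟨hzV, hz⟩, hzi⟩
      have hcases : c y = i ∨ c a = i ∨ c b = i := by
        generalize c y = p at *
        generalize c a = q at *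
        generalize c b = r at *
        clear hmemW
        omega
      rcases hcases with e | e | e
      · exact Or.inl (hmemW _ (h.mem _ _ hya).1 hy e)
      · exact Or.inr ⟨a, hmemW _ (h.mem _ _ hya).2 ha e, hya.symm⟩
      · exact Or.inr ⟨b, hmemW _ (h.mem _ _ hyb).2 hb e, hyb.symm⟩
    refine ⟨fun x hx => ?_, ?_⟩
    · simp only [hW, Finset.mem_filter] at hx
      exact hx.1.1
    · intro x y z _ _ _ hx hy _ hxy _
      rcases h.indep h4 x y hxy with hT | hT
      · exact absurd (hdom x hT) hx
      · exact absurd (hdom y hT) hy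
  have hle : ∀ i : Fin 3, iota1 G V ≤ (W.filter fun x => c x = i).card :=
    fun i => Nat.sInf_le ⟨_, hiso i, rfl⟩
  have hfib : W.card = ∑ i : Fin 3, (W.filter fun x => c x = i).card :=
    Finset.card_eq_sum_card_fiberwise fun x _ => by simp
  rw [Fin.sum_univ_three] at hfib
  have h0 := hle 0
  have h1 := hle 1
  have h2 := hle 2
  have hfin : 3 * iota1 G V + numDeg2 G V ≤ V.card := by omega
  have hq : (3 : ℚ) * iota1 G V + numDeg2 G V ≤ V.card := by exact_mod_cast hfin
  linarith
end

section
/- If G is a maximal outerplanar graph of order 5 ≤ n ≤ 9, then the K_{1,2}-isolation number of G equals 1 (and hence ι₁(G) ≤ n/5). -/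
open SimpleGraph

/-- A combinatorial model: list of edges and list of cycle edges on vertices `0, …, n-1`. -/
abbrev MopModel := List (ℕ × ℕ) × List (ℕ × ℕ)

/-- The model `m` on `n` labels represents the graph `G` on `V` with cycle `K`. -/
def MopRep (n : ℕ) (m : MopModel) (G : SimpleGraph ℕ) (V : Finset ℕ) (K : Finset (Sym2 ℕ)) : Prop :=
  ∃ f : ℕ → ℕ, (∀ i < n, ∀ j < n, f i = f j → i = j) ∧ (∀ x, x ∈ V ↔ ∃ i < n, f i = x) ∧
    (∀ p ∈ m.1, p.1 < n ∧ p.2 < n) ∧ (∀ p ∈ m.2, p.1 < n ∧ p.2 < n) ∧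
    (∀ x y, G.Adj x y → ∃ p ∈ m.1, s(x, y) = s(f p.1, f p.2)) ∧
    (∀ p ∈ m.1, G.Adj (f p.1) (f p.2)) ∧
    (∀ e ∈ K, ∃ p ∈ m.2, e = s(f p.1, f p.2))

/-- Grow a model at the cycle edge `p`. -/
def growAt (n : ℕ) (m : MopModel) (p : ℕ × ℕ) : MopModel :=
  ((p.1, n) :: (p.2, n) :: m.1, (p.1, n) :: (p.2, n) :: m.2.erase p)

theorem MopRep.grow {n : ℕ} {m : MopModel} {G : SimpleGraph ℕ} {V : Finset ℕ}
    {K : Finset (Sym2 ℕ)} (h : MopRep n m G V K) {u v w : ℕ} (huv : s(u, v) ∈ K) (hw : w ∉ V) :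
    ∃ p ∈ m.2, MopRep (n + 1) (growAt n m p)
      (SimpleGraph.fromEdgeSet (insert s(u, w) (insert s(v, w) G.edgeSet)))
        (insert w V) (insert s(u, w) (insert s(v, w) (K.erase s(u, v)))) := by
  obtain ⟨f, hinj, hV, hE, hC, hA, hA', hK⟩ := h
  obtain ⟨p, hp, hpe⟩ := hK _ huv
  refine ⟨p, hp, fun i => if i < n then f i else w, ?_, ?_, ?_, ?_, ?_, ?_, ?_⟩
  · intro i hi j hj hij
    have hne : ∀ k < n, f k ≠ w := fun k hk hkw => hw ((hV w).2 ⟨k, hk, hkw⟩)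
    by_cases h1 : i < n <;> by_cases h2 : j < n
    · simp only [h1, h2, if_true] at hij; exact hinj i h1 j h2 hij
    · simp only [h1, h2, if_true, if_false] at hij; exact absurd hij (hne i h1)
    · simp only [h1, h2, if_true, if_false] at hij; exact absurd hij.symm (hne j h2)
    · omega
  · intro x
    rw [Finset.mem_insert, hV]
    constructor
    · rintro (rfl | ⟨i, hi, rfl⟩)
      · exact ⟨n, by omega, by simp⟩
      · exact ⟨i, by omega, by simp [hi]⟩
    · rintro ⟨i, hi, rfl⟩
      by_cases h1 : i < n
      · right; exact ⟨i, h1, by simp [h1]⟩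
      · left; simp [h1]
  · have := hC p hp
    intro q hq
    simp only [growAt, List.mem_cons] at hq
    rcases hq with rfl | rfl | hq
    · exact ⟨by simp only; omega, by simp only; omega⟩
    · exact ⟨by simp only; omega, by simp only; omega⟩
    · have := hE q hq; omega
  · have := hC p hp
    intro q hq
    simp only [growAt, List.mem_cons] at hq
    rcases hq with rfl | rfl | hq
    · exact ⟨by simp only; omega, by simp only; omega⟩
    · exact ⟨by simp only; omega, by simp only; omega⟩
    · have := hC q (List.mem_of_mem_erase hq); omega
  · intro x y hxy
    rw [SimpleGraph.fromEdgeSet_adj, Set.mem_insert_iff, Set.mem_insert_iff] at hxy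
    obtain ⟨hxy, -⟩ := hxy
    obtain ⟨hp1, hp2⟩ := hC p hp
    have hold : s(x, y) ∈ G.edgeSet → ∃ q ∈ (growAt n m p).1,
        s(x, y) = s((if q.1 < n then f q.1 else w), (if q.2 < n then f q.2 else w)) := by
      intro h
      obtain ⟨q, hq, hqe⟩ := hA x y h
      obtain ⟨h1, h2⟩ := hE q hq
      exact ⟨q, by simp [growAt, hq], by simp [h1, h2, hqe]⟩
    have hn1 : ∃ q ∈ (growAt n m p).1,
        s(f p.1, w) = s((if q.1 < n then f q.1 else w), (if q.2 < n then f q.2 else w)) :=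
      ⟨(p.1, n), by simp [growAt], by simp [hp1]⟩
    have hn2 : ∃ q ∈ (growAt n m p).1,
        s(f p.2, w) = s((if q.1 < n then f q.1 else w), (if q.2 < n then f q.2 else w)) :=
      ⟨(p.2, n), by simp [growAt], by simp [hp2]⟩
    rcases Sym2.eq_iff.1 hpe with ⟨rfl, rfl⟩ | ⟨rfl, rfl⟩
    · rcases hxy with h | h | h
      · rw [h]; exact hn1
      · rw [h]; exact hn2
      · exact hold h
    · rcases hxy with h | h | h
      · rw [h]; exact hn2
      · rw [h]; exact hn1
      · exact hold h
  · obtain ⟨hp1, hp2⟩ := hC p hp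
    have hne : ∀ k < n, f k ≠ w := fun k hk hkw => hw ((hV w).2 ⟨k, hk, hkw⟩)
    have h1 : s(f p.1, w) = s(u, w) ∨ s(f p.1, w) = s(v, w) := by
      rcases Sym2.eq_iff.1 hpe with ⟨rfl, rfl⟩ | ⟨rfl, rfl⟩ <;> simp
    have h2 : s(f p.2, w) = s(u, w) ∨ s(f p.2, w) = s(v, w) := by
      rcases Sym2.eq_iff.1 hpe with ⟨rfl, rfl⟩ | ⟨rfl, rfl⟩ <;> simp
    intro q hq
    rw [SimpleGraph.fromEdgeSet_adj, Set.mem_insert_iff, Set.mem_insert_iff]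
    simp only [growAt, List.mem_cons] at hq
    rcases hq with rfl | rfl | hq
    · simp only [hp1, lt_irrefl, if_true, if_false]
      exact ⟨by tauto, hne _ hp1⟩
    · simp only [hp2, lt_irrefl, if_true, if_false]
      exact ⟨by tauto, hne _ hp2⟩
    · obtain ⟨h3, h4⟩ := hE q hq
      simp only [h3, h4, if_true]
      exact ⟨Or.inr (Or.inr (hA' q hq)), (hA' q hq).ne⟩
  · intro e he
    rw [Finset.mem_insert, Finset.mem_insert, Finset.mem_erase] at he
    obtain ⟨hp1, hp2⟩ := hC p hp
    have hold : (e ≠ s(u, v) ∧ e ∈ K) → ∃ q ∈ (growAt n m p).2,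
        e = s((if q.1 < n then f q.1 else w), (if q.2 < n then f q.2 else w)) := by
      rintro ⟨h, h'⟩
      obtain ⟨q, hq, hqe⟩ := hK e h'
      obtain ⟨h1, h2⟩ := hC q hq
      have hqp : q ≠ p := by
        rintro rfl
        exact h (hqe.trans hpe.symm)
      exact ⟨q, by simp [growAt, (List.mem_erase_of_ne hqp).2 hq], by simp [h1, h2, hqe]⟩
    have hn1 : ∃ q ∈ (growAt n m p).2,
        s(f p.1, w) = s((if q.1 < n then f q.1 else w), (if q.2 < n then f q.2 else w)) :=
      ⟨(p.1, n), by simp [growAt], by simp [hp1]⟩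
    have hn2 : ∃ q ∈ (growAt n m p).2,
        s(f p.2, w) = s((if q.1 < n then f q.1 else w), (if q.2 < n then f q.2 else w)) :=
      ⟨(p.2, n), by simp [growAt], by simp [hp2]⟩
    rcases Sym2.eq_iff.1 hpe with ⟨rfl, rfl⟩ | ⟨rfl, rfl⟩
    · rcases he with h | h | h
      · rw [h]; exact hn1
      · rw [h]; exact hn2
      · exact hold h
    · rcases he with h | h | h
      · rw [h]; exact hn2
      · rw [h]; exact hn1
      · exact hold h

/-- `σ` (a permutation of the labels) carries the model `m'` onto the model `m`. -/
def Relabels (n : ℕ) (σ : List ℕ) (m m' : MopModel) : Prop :=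
  (∀ i < n, σ.getD i 0 < n) ∧ (∀ i < n, ∀ j < n, σ.getD i 0 = σ.getD j 0 → i = j) ∧
  (∀ i < n, ∃ j < n, σ.getD j 0 = i) ∧
  (∀ p ∈ m'.1, p.1 < n ∧ p.2 < n) ∧ (∀ p ∈ m'.2, p.1 < n ∧ p.2 < n) ∧
  (∀ p ∈ m'.1, (σ.getD p.1 0, σ.getD p.2 0) ∈ m.1 ∨ (σ.getD p.2 0, σ.getD p.1 0) ∈ m.1) ∧
  (∀ q ∈ m.1, ∃ p ∈ m'.1, (σ.getD p.1 0, σ.getD p.2 0) = q ∨ (σ.getD p.2 0, σ.getD p.1 0) = q) ∧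
  (∀ q ∈ m.2, ∃ p ∈ m'.2, (σ.getD p.1 0, σ.getD p.2 0) = q ∨ (σ.getD p.2 0, σ.getD p.1 0) = q)

instance (n : ℕ) (σ : List ℕ) (m m' : MopModel) : Decidable (Relabels n σ m m') := by
  unfold Relabels; infer_instance

theorem MopRep.relabel {n : ℕ} {m m' : MopModel} {G : SimpleGraph ℕ} {V : Finset ℕ}
    {K : Finset (Sym2 ℕ)} (h : MopRep n m G V K) (σ : List ℕ) (hσ : Relabels n σ m m') :
    MopRep n m' G V K := by
  obtain ⟨f, hinj, hV, hE, hC, hA, hA', hK⟩ := h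
  obtain ⟨s1, s2, s3, s4, s5, s6, s7, s8⟩ := hσ
  refine ⟨fun i => f (σ.getD i 0), ?_, ?_, s4, s5, ?_, ?_, ?_⟩
  · intro i hi j hj hij
    exact s2 i hi j hj (hinj _ (s1 i hi) _ (s1 j hj) hij)
  · intro x
    rw [hV]
    constructor
    · rintro ⟨i, hi, rfl⟩
      obtain ⟨j, hj, rfl⟩ := s3 i hi
      exact ⟨j, hj, rfl⟩
    · rintro ⟨i, hi, rfl⟩
      exact ⟨_, s1 i hi, rfl⟩
  · intro x y hxy
    obtain ⟨q, hq, hqe⟩ := hA x y hxy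
    obtain ⟨p, hp, rfl | rfl⟩ := s7 q hq
    · exact ⟨p, hp, hqe⟩
    · exact ⟨p, hp, hqe.trans Sym2.eq_swap⟩
  · intro p hp
    rcases s6 p hp with h | h
    · exact hA' _ h
    · exact (hA' _ h).symm
  · intro e he
    obtain ⟨q, hq, hqe⟩ := hK e he
    obtain ⟨p, hp, rfl | rfl⟩ := s8 q hq
    · exact ⟨p, hp, hqe⟩
    · exact ⟨p, hp, hqe.trans Sym2.eq_swap⟩

/-- The triangle. -/
def model3 : MopModel := ([(0, 1), (1, 2), (0, 2)], [(0, 1), (1, 2), (0, 2)])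
/-- The unique mop of order 4. -/
def model4 : MopModel := growAt 3 model3 (0, 1)
/-- The unique mop of order 5. -/
def model5 : MopModel := growAt 4 model4 (0, 3)

/-- All one-vertex extensions of a list of models. -/
def growAll (n : ℕ) (l : List MopModel) : List MopModel :=
  l.flatMap fun m => m.2.map (growAt n m)

/-- Representatives of all mops of order `n`. -/
def models : ℕ → List MopModel
  | 0 => []
  | 1 => []
  | 2 => []
  | 3 => [model3]
  | 4 => [model4]
  | 5 => [model5]
  | (n + 6) => growAll (n + 5) (models (n + 5))

theorem step3 : ∀ p ∈ model3.2,
    ∃ σ ∈ [[0, 1, 2, 3], [1, 2, 0, 3], [0, 2, 1, 3]], Relabels 4 σ (growAt 3 model3 p) model4 := by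
  decide +kernel

theorem step4 : ∀ p ∈ model4.2,
    ∃ σ ∈ [[0, 1, 2, 3, 4], [1, 0, 2, 3, 4], [0, 1, 3, 2, 4], [1, 0, 3, 2, 4]],
      Relabels 5 σ (growAt 4 model4 p) model5 := by
  decide +kernel

theorem exists_model {G : SimpleGraph ℕ} {V : Finset ℕ} {K : Finset (Sym2 ℕ)}
    (h : IsMopCycle G V K) : ∃ m ∈ models V.card, MopRep V.card m G V K := by
  induction h with
  | triangle a b c hab hac hbc =>
    have hc : ({a, b, c} : Finset ℕ).card = 3 := Finset.card_eq_three.2 ⟨a, b, c, hab, hac, hbc, rfl⟩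
    rw [hc]
    refine ⟨model3, by simp [models], fun i => [a, b, c].getD i 0, ?_, ?_, by decide, by decide,
      ?_, ?_, ?_⟩
    · intro i hi j hj
      interval_cases i <;> interval_cases j <;> simp [hab, hac, hbc, hab.symm, hac.symm, hbc.symm]
    · intro x
      simp only [Finset.mem_insert, Finset.mem_singleton]
      constructor
      · rintro (rfl | rfl | rfl)
        · exact ⟨0, by simp⟩
        · exact ⟨1, by simp⟩
        · exact ⟨2, by simp⟩
      · rintro ⟨i, hi, rfl⟩
        interval_cases i <;> simp
    · intro x y hxy
      rw [SimpleGraph.fromEdgeSet_adj] at hxy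
      simpa [model3] using hxy.1
    · intro p hp
      simp only [model3, List.mem_cons, List.not_mem_nil, or_false] at hp
      rcases hp with rfl | rfl | rfl <;> simp [hab, hac, hbc]
    · intro e he
      simpa [model3] using he
  | grow G V C u v w hG huv hw ih =>
    obtain ⟨m, hm, hr⟩ := ih
    obtain ⟨p, hp, hr'⟩ := hr.grow huv hw
    rw [Finset.card_insert_of_notMem hw]
    generalize V.card = n at hm hr'
    match n, hm, hr' with
    | 0, hm, _ => simp [models] at hm
    | 1, hm, _ => simp [models] at hm
    | 2, hm, _ => simp [models] at hm
    | 3, hm, hr' =>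
      have : m = model3 := by simpa [models] using hm
      subst this
      obtain ⟨σ, -, hσ⟩ := step3 p hp
      exact ⟨model4, by simp [models], hr'.relabel σ hσ⟩
    | 4, hm, hr' =>
      have : m = model4 := by simpa [models] using hm
      subst this
      obtain ⟨σ, -, hσ⟩ := step4 p hp
      exact ⟨model5, by simp [models], hr'.relabel σ hσ⟩
    | k + 5, hm, hr' =>
      exact ⟨_, List.mem_flatMap.2 ⟨m, hm, List.mem_map.2 ⟨p, hp, rfl⟩⟩, hr'⟩

/-- Is `x` in the closed neighbourhood of `v`? -/
def inNbhd (E : List (ℕ × ℕ)) (v x : ℕ) : Bool :=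
  Nat.beq x v || E.any fun p =>
    (Nat.beq p.1 v && Nat.beq p.2 x) || (Nat.beq p.2 v && Nat.beq p.1 x)

/-- The edges of the model remaining after deletion of the closed neighbourhood of `v`. -/
def remaining (E : List (ℕ × ℕ)) (v : ℕ) : List (ℕ × ℕ) :=
  E.filter fun p => !(inNbhd E v p.1 || inNbhd E v p.2)

/-- The edges in the list are pairwise equal or disjoint. -/
def isMatch (R : List (ℕ × ℕ)) : Bool :=
  R.all fun p => R.all fun q => (Nat.beq p.1 q.1 && Nat.beq p.2 q.2) ||
    !(Nat.beq p.1 q.1 || Nat.beq p.1 q.2 || Nat.beq p.2 q.1 || Nat.beq p.2 q.2)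

/-- Some vertex of the model is isolating. -/
def goodModel (n : ℕ) (m : MopModel) : Bool :=
  (List.range n).any fun v => isMatch (remaining m.1 v)

theorem all_good : ∀ n ∈ [5, 6, 7, 8, 9], (models n).all (goodModel n) = true := by
  decide +kernel

theorem not_inNbhd {G : SimpleGraph ℕ} {E : List (ℕ × ℕ)} {f : ℕ → ℕ}
    (hA' : ∀ p ∈ E, G.Adj (f p.1) (f p.2)) {v i : ℕ}
    (h : f i ∉ closedNbhd G {f v}) : inNbhd E v i = false := by
  by_contra hc
  apply h
  simp only [Bool.not_eq_false, inNbhd, Bool.or_eq_true, List.any_eq_true, Bool.and_eq_true,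
    Nat.beq_eq] at hc
  simp only [closedNbhd, Finset.mem_singleton, Set.mem_ofPred_eq, exists_eq_left]
  rcases hc with rfl | ⟨p, hp, ⟨rfl, rfl⟩ | ⟨rfl, rfl⟩⟩
  · left; rfl
  · right; exact hA' p hp
  · right; exact (hA' p hp).symm

theorem MopRep.isolating {n : ℕ} {m : MopModel} {G : SimpleGraph ℕ} {V : Finset ℕ}
    {K : Finset (Sym2 ℕ)} (h : MopRep n m G V K) (hg : goodModel n m = true) :
    ∃ S : Finset ℕ, IsIsolating12 G V S ∧ S.card = 1 := by
  obtain ⟨f, hinj, hV, hE, hC, hA, hA', hK⟩ := h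
  simp only [goodModel, List.any_eq_true, List.mem_range] at hg
  obtain ⟨v, hv, hm⟩ := hg
  refine ⟨{f v}, ⟨?_, ?_⟩, Finset.card_singleton _⟩
  · rw [Finset.singleton_subset_iff, hV]; exact ⟨v, hv, rfl⟩
  · intro x y z _ _ _ hx hy hz hxy hxz
    obtain ⟨p, hp, hpe⟩ := hA x y hxy
    obtain ⟨q, hq, hqe⟩ := hA x z hxz
    have key : ∀ t, t ∉ closedNbhd G {f v} → ∀ r ∈ m.1, s(x, t) = s(f r.1, f r.2) →
        r ∈ remaining m.1 v := by
      intro t ht r hr he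
      have h12 : f r.1 ∉ closedNbhd G {f v} ∧ f r.2 ∉ closedNbhd G {f v} := by
        rcases Sym2.eq_iff.1 he with ⟨h1, h2⟩ | ⟨h1, h2⟩
        · exact ⟨h1 ▸ hx, h2 ▸ ht⟩
        · exact ⟨h2 ▸ ht, h1 ▸ hx⟩
      simp [remaining, hr, not_inNbhd hA' h12.1, not_inNbhd hA' h12.2]
    have hpR := key y hy p hp hpe
    have hqR := key z hz q hq hqe
    have := (List.all_eq_true.1 (List.all_eq_true.1 hm p hpR)) q hqR
    simp only [Bool.or_eq_true, Bool.and_eq_true, Nat.beq_eq, Bool.not_eq_true',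
      Bool.or_eq_false_iff] at this
    rcases this with ⟨h1, h2⟩ | ⟨⟨⟨h1, h2⟩, h3⟩, h4⟩
    · have : s(x, y) = s(x, z) := by rw [hpe, hqe, h1, h2]
      exact Sym2.congr_right.1 this
    · exfalso
      obtain ⟨b1, b2⟩ := hE p hp
      obtain ⟨b3, b4⟩ := hE q hq
      have e1 := Nat.ne_of_beq_eq_false h1
      have e2 := Nat.ne_of_beq_eq_false h2
      have e3 := Nat.ne_of_beq_eq_false h3
      have e4 := Nat.ne_of_beq_eq_false h4
      rcases Sym2.eq_iff.1 hpe with ⟨h5, -⟩ | ⟨h5, -⟩ <;>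
        rcases Sym2.eq_iff.1 hqe with ⟨h6, -⟩ | ⟨h6, -⟩
      · exact e1 (hinj _ b1 _ b3 (h5.symm.trans h6))
      · exact e2 (hinj _ b1 _ b4 (h5.symm.trans h6))
      · exact e3 (hinj _ b2 _ b3 (h5.symm.trans h6))
      · exact e4 (hinj _ b2 _ b4 (h5.symm.trans h6))

theorem exists_star {G : SimpleGraph ℕ} {V : Finset ℕ} {K : Finset (Sym2 ℕ)}
    (h : IsMopCycle G V K) :
    ∃ x ∈ V, ∃ y ∈ V, ∃ z ∈ V, G.Adj x y ∧ G.Adj x z ∧ y ≠ z := by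
  induction h with
  | triangle a b c hab hac hbc =>
    exact ⟨a, by simp, b, by simp, c, by simp, by simp [hab], by simp [hac], hbc⟩
  | grow G V C u v w hG huv hw ih =>
    obtain ⟨x, hx, y, hy, z, hz, h1, h2, h3⟩ := ih
    refine ⟨x, by simp [hx], y, by simp [hy], z, by simp [hz], ?_, ?_, h3⟩
    · rw [SimpleGraph.fromEdgeSet_adj]
      exact ⟨Or.inr (Or.inr h1), h1.ne⟩
    · rw [SimpleGraph.fromEdgeSet_adj]
      exact ⟨Or.inr (Or.inr h2), h2.ne⟩

/-- **Lemma 9.** If `G` is a mop of order `n` with `5 ≤ n ≤ 9`, then `ι₁(G) = 1`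
(and hence `ι₁(G) ≤ n / 5`). -/
theorem mop_iota1_eq_one_of_card_between (G : SimpleGraph ℕ) (V : Finset ℕ)
    (hG : IsMop G V) (h5 : 5 ≤ V.card) (h9 : V.card ≤ 9) :
    iota1 G V = 1 ∧ (iota1 G V : ℚ) ≤ (V.card : ℚ) / 5 := by
  obtain ⟨K, hK⟩ := hG
  have h1 : iota1 G V = 1 := by
    obtain ⟨m, hm, hr⟩ := exists_model hK
    have hmem : V.card ∈ [5, 6, 7, 8, 9] := by
      simp only [List.mem_cons, List.not_mem_nil, or_false]; omega
    have hone := hr.isolating (List.all_eq_true.1 (all_good _ hmem) m hm)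
    apply le_antisymm
    · exact Nat.sInf_le hone
    · refine le_csInf ⟨1, hone⟩ ?_
      rintro k ⟨S, hS, rfl⟩
      rw [Nat.one_le_iff_ne_zero]
      intro h0
      rw [Finset.card_eq_zero] at h0
      subst h0
      obtain ⟨x, hx, y, hy, z, hz, a1, a2, a3⟩ := exists_star hK
      exact a3 (hS.2 x y z hx hy hz (by simp [closedNbhd]) (by simp [closedNbhd])
        (by simp [closedNbhd]) a1 a2)
  refine ⟨h1, ?_⟩
  rw [h1]
  have : (5 : ℚ) ≤ (V.card : ℚ) := by exact_mod_cast h5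
  push_cast
  linarith
end

section
/- (Chvátal) If G is a maximal outerplanar graph of order n ≥ 8, then G has a diagonal d that partitions G into two maximal outerplanar graphs G₁ and G₂ (i.e., G is the union of G₁ and G₂, V(G₁) ∩ V(G₂) consists of the two endpoints of d, and E(G₁) ∩ E(G₂) = {d}) such that G₁ contains exactly 4, 5 or 6 Hamiltonian edges of G. -/
open SimpleGraph

/-- A triangulated polygon rooted at the edge `xy`: edges `E`, vertices `V`, and the
edges `P` of the boundary path from `x` to `y`. -/
inductive Piece : ℕ → ℕ → Finset (Sym2 ℕ) → Finset ℕ → Finset (Sym2 ℕ) → Prop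
  | leaf (x y : ℕ) (h : x ≠ y) : Piece x y {s(x, y)} {x, y} {s(x, y)}
  | node (x y z : ℕ) (E₁ E₂ : Finset (Sym2 ℕ)) (V₁ V₂ : Finset ℕ) (P₁ P₂ : Finset (Sym2 ℕ))
      (h₁ : Piece x z E₁ V₁ P₁) (h₂ : Piece z y E₂ V₂ P₂)
      (hV : ∀ a, a ∈ V₁ → a ∈ V₂ → a = z) :
      Piece x y (insert s(x, y) (E₁ ∪ E₂)) (V₁ ∪ V₂) (P₁ ∪ P₂)

theorem Piece.basic {x y E V P} (h : Piece x y E V P) :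
    x ≠ y ∧ x ∈ V ∧ y ∈ V ∧ s(x, y) ∈ E ∧ P ⊆ E ∧
    (∀ a b, s(a, b) ∈ E → a ∈ V ∧ b ∈ V ∧ a ≠ b) := by
  induction h with
  | leaf x y h =>
    refine ⟨h, by simp, by simp, by simp, by simp, ?_⟩
    intro a b hab
    simp only [Finset.mem_singleton, Sym2.eq_iff] at hab
    grind
  | node x y z E₁ E₂ V₁ V₂ P₁ P₂ h₁ h₂ hV ih₁ ih₂ =>
    obtain ⟨a1, a2, a3, a4, a5, a6⟩ := ih₁
    obtain ⟨b1, b2, b3, b4, b5, b6⟩ := ih₂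
    have hxy : x ≠ y := by
      rintro rfl
      exact a1 (hV _ a2 b3)
    refine ⟨hxy, by simp [a2], by simp [b3], by simp, ?_, ?_⟩
    · intro e he
      rcases Finset.mem_union.1 he with he | he
      · simp [a5 he]
      · simp [b5 he]
    · intro a b hab
      simp only [Finset.mem_insert, Finset.mem_union, Sym2.eq_iff] at hab
      grind

theorem Piece.edge {x y E V P} (h : Piece x y E V P) {a b : ℕ} (hab : s(a, b) ∈ E) :
    a ∈ V ∧ b ∈ V ∧ a ≠ b := h.basic.2.2.2.2.2 a b hab

theorem Piece.edgeP {x y E V P} (h : Piece x y E V P) {a b : ℕ} (hab : s(a, b) ∈ P) :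
    a ∈ V ∧ b ∈ V ∧ a ≠ b := h.edge (h.basic.2.2.2.2.1 hab)

theorem node_disj {x y z x' y' E₁ E₂ V₁ V₂ P₁ P₂}
    (h₁ : Piece x y E₁ V₁ P₁) (h₂ : Piece x' y' E₂ V₂ P₂)
    (hV : ∀ a, a ∈ V₁ → a ∈ V₂ → a = z) (a b : ℕ) (ha : s(a, b) ∈ P₁) (hb : s(a, b) ∈ P₂) :
    False := by
  obtain ⟨p, q, r⟩ := h₁.edgeP ha
  obtain ⟨p', q', r'⟩ := h₂.edgeP hb
  exact r ((hV _ p p').trans (hV _ q q').symm)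

theorem Piece.card {x y E V P} (h : Piece x y E V P) :
    P.card + 1 = V.card ∧ 1 ≤ P.card := by
  induction h with
  | leaf x y h => simp [h]
  | node x y z E₁ E₂ V₁ V₂ P₁ P₂ h₁ h₂ hV ih₁ ih₂ =>
    have hd : Disjoint P₁ P₂ := by
      rw [Finset.disjoint_left]
      intro e
      induction e with | _ a b
      exact node_disj h₁ h₂ hV a b
    have hi : V₁ ∩ V₂ = {z} := by
      have := h₁.basic
      have := h₂.basic
      ext a
      simp only [Finset.mem_inter, Finset.mem_singleton]
      grind
    have := Finset.card_union_add_card_inter V₁ V₂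
    rw [hi, Finset.card_singleton] at this
    rw [Finset.card_union_of_disjoint hd]
    omega

theorem Piece.root_notMem {x y E V P} (h : Piece x y E V P) (hP : 2 ≤ P.card) :
    s(x, y) ∉ P := by
  induction h with
  | leaf x y h => simp at hP
  | node x y z E₁ E₂ V₁ V₂ P₁ P₂ h₁ h₂ hV _ _ =>
    intro hm
    have a := h₁.basic
    have b := h₂.basic
    rcases Finset.mem_union.1 hm with hm | hm
    · have := h₁.edgeP hm
      grind
    · have := h₂.edgeP hm
      grind

theorem Piece.swap {x y E V P} (h : Piece x y E V P) : Piece y x E V P := by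
  induction h with
  | leaf x y h =>
    have := Piece.leaf y x h.symm
    rwa [Sym2.eq_swap, Finset.pair_comm] at this
  | node x y z E₁ E₂ V₁ V₂ P₁ P₂ h₁ h₂ hV ih₁ ih₂ =>
    have := Piece.node y x z E₂ E₁ V₂ V₁ P₂ P₁ ih₂ ih₁ (fun a p q => hV a q p)
    rwa [Sym2.eq_swap, Finset.union_comm E₂, Finset.union_comm V₂, Finset.union_comm P₂] at this

set_option maxHeartbeats 1000000 in
theorem Piece.replace {x y E V P} (h : Piece x y E V P) (u v w : ℕ) (huv : s(u, v) ∈ P)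
    (hw : w ∉ V) : Piece x y (insert s(u, w) (insert s(v, w) E)) (insert w V)
      (insert s(u, w) (insert s(v, w) (P.erase s(u, v)))) := by
  induction h with
  | leaf x y h =>
    have hx : x ≠ w := by rintro rfl; simp at hw
    have hy : y ≠ w := by rintro rfl; simp at hw
    have := Piece.node x y w _ _ _ _ _ _ (Piece.leaf x w hx) (Piece.leaf w y hy.symm)
      (by intro a; simp; grind)
    convert this using 1
    · ext e
      induction e with | _ a b
      simp only [Finset.mem_singleton, Finset.mem_insert, Finset.mem_union, Sym2.eq_iff] at huv ⊢
      grind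
    · ext e
      simp
      grind
    · ext e
      induction e with | _ a b
      simp only [Finset.mem_singleton, Finset.mem_insert, Finset.mem_union, Finset.mem_erase,
        Sym2.eq_iff, ne_eq] at huv ⊢
      grind
  | node x y z E₁ E₂ V₁ V₂ P₁ P₂ h₁ h₂ hV ih₁ ih₂ =>
    have hw1 : w ∉ V₁ := fun h => hw (Finset.mem_union_left _ h)
    have hw2 : w ∉ V₂ := fun h => hw (Finset.mem_union_right _ h)
    have hd := node_disj h₁ h₂ hV u v
    rcases Finset.mem_union.1 huv with hm | hm
    · have := Piece.node x y z _ _ _ _ _ _ (ih₁ hm hw1) h₂ (by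
        intro a; simp only [Finset.mem_insert]; grind)
      convert this using 1
      · ext e; simp only [Finset.mem_insert, Finset.mem_union]; tauto
      · ext e; simp only [Finset.mem_insert, Finset.mem_union]; tauto
      · ext e; simp only [Finset.mem_insert, Finset.mem_union, Finset.mem_erase]; grind
    · have := Piece.node x y z _ _ _ _ _ _ h₁ (ih₂ hm hw2) (by
        intro a; simp only [Finset.mem_insert]; grind)
      convert this using 1
      · ext e; simp only [Finset.mem_insert, Finset.mem_union]; tauto
      · ext e; simp only [Finset.mem_insert, Finset.mem_union]; tauto
      · ext e; simp only [Finset.mem_insert, Finset.mem_union, Finset.mem_erase]; grind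

theorem edgeSet_from {S : Set (Sym2 ℕ)} (h : ∀ a b, s(a, b) ∈ S → a ≠ b) :
    (SimpleGraph.fromEdgeSet S).edgeSet = S := by
  ext e
  induction e with | _ a b
  simp only [mem_edgeSet, fromEdgeSet_adj]
  exact ⟨fun h => h.1, fun h' => ⟨h', h _ _ h'⟩⟩

theorem mop_piece {G V C} (h : IsMopCycle G V C) :
    ∃ x y E P, Piece x y E V P ∧ G.edgeSet = (E : Set (Sym2 ℕ)) ∧ C = insert s(x, y) P ∧
      2 ≤ P.card := by
  induction h with
  | triangle a b c hab hac hbc =>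
    have := Piece.node a c b _ _ _ _ _ _ (Piece.leaf a b hab) (Piece.leaf b c hbc) (by
      intro d; simp; grind)
    refine ⟨a, c, insert s(a, c) ({s(a, b)} ∪ {s(b, c)}), {s(a, b)} ∪ {s(b, c)}, ?_, ?_, ?_, ?_⟩
    · convert this using 1
      ext e; simp
    · rw [edgeSet_from]
      · ext e; simp; tauto
      · intro p q; simp; grind
    · ext e; simp; tauto
    · have h2 := this.card.1
      have : ({a, b} ∪ {b, c} : Finset ℕ) = {a, b, c} := by ext e; simp
      rw [this, Finset.card_eq_three.2 ⟨a, b, c, hab, hac, hbc, rfl⟩] at h2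
      omega
  | grow G V C u v w hG huv hw ih =>
    obtain ⟨x, y, E, P, hp, hE, hC, hP⟩ := ih
    have hb := hp.basic
    have hc := hp.card
    have hr := hp.root_notMem hP
    have huvE : s(u, v) ∈ E := by
      rw [hC, Finset.mem_insert] at huv
      rcases huv with h | h
      · rw [h]; exact hb.2.2.2.1
      · exact hb.2.2.2.2.1 h
    have he := hp.edge huvE
    have hset : (SimpleGraph.fromEdgeSet (insert s(u, w) (insert s(v, w) G.edgeSet))).edgeSet
        = ((insert s(u, w) (insert s(v, w) E) : Finset (Sym2 ℕ)) : Set (Sym2 ℕ)) := by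
      rw [hE, edgeSet_from]
      · push_cast; rfl
      · intro p q h
        simp only [Set.mem_insert_iff, Sym2.eq_iff, Finset.mem_coe] at h
        have := fun h => hp.edge (a := p) (b := q) h
        grind
    rcases (show s(u, v) = s(x, y) ∨ s(u, v) ∈ P by rwa [hC, Finset.mem_insert] at huv) with h | h
    · have huvp : Piece u v E V P := by
        rw [Sym2.eq_iff] at h
        rcases h with ⟨rfl, rfl⟩ | ⟨rfl, rfl⟩
        · exact hp
        · exact hp.swap
      have hvw : v ≠ w := by rintro rfl; exact hw he.2.1
      have := Piece.node u w v _ _ _ _ _ _ huvp (Piece.leaf v w hvw) (by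
        intro a; simp; grind)
      have hVe : insert w V = V ∪ {v, w} := by ext e; simp; grind
      refine ⟨u, w, _, _, hVe ▸ this, ?_, ?_, ?_⟩
      · rw [hset]
        congr 1
        ext e; simp only [Finset.mem_insert, Finset.mem_union, Finset.mem_singleton]; tauto
      · rw [hC, h, Finset.erase_insert hr]
        ext e; simp only [Finset.mem_insert, Finset.mem_union, Finset.mem_singleton]; tauto
      · have := Finset.card_le_card (Finset.subset_union_left (s₁ := P) (s₂ := {s(v, w)}))
        omega
    · have hrep := hp.replace u v w h hw
      refine ⟨x, y, _, _, hrep, hset, ?_, ?_⟩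
      · rw [hC, Finset.erase_insert_of_ne]
        · ext e; simp only [Finset.mem_insert]; tauto
        · intro h'; rw [h'] at hr; exact hr h
      · have := hrep.card.1
        rw [Finset.card_insert_of_notMem hw] at this
        omega

theorem mop_edge {G V C} (h : IsMopCycle G V C) {a b : ℕ} (hab : s(a, b) ∈ G.edgeSet) :
    a ∈ V ∧ b ∈ V ∧ a ≠ b := by
  obtain ⟨x, y, E, P, hp, hE, hC, hP⟩ := mop_piece h
  rw [hE] at hab
  exact hp.edge hab

theorem mop_sub {G V C} (h : IsMopCycle G V C) {e} (he : e ∈ C) : e ∈ G.edgeSet := by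
  obtain ⟨x, y, E, P, hp, hE, hC, hP⟩ := mop_piece h
  rw [hE]
  have := hp.basic
  rw [hC, Finset.mem_insert] at he
  rcases he with rfl | he
  · exact this.2.2.2.1
  · exact this.2.2.2.2.1 he

theorem mop_cyc {G V C} (h : IsMopCycle G V C) {a b : ℕ} (hab : s(a, b) ∈ C) :
    a ∈ V ∧ b ∈ V ∧ a ≠ b := mop_edge h (mop_sub h hab)

theorem glue {x y E V P} (h : Piece x y E V P) : ∀ G W C, IsMopCycle G W C → s(x, y) ∈ C →
    (∀ a, a ∈ V → a ∈ W → a = x ∨ a = y) →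
    ∃ G', G'.edgeSet = G.edgeSet ∪ E ∧ IsMopCycle G' (W ∪ V) (C.erase s(x, y) ∪ P) := by
  induction h with
  | leaf x y h =>
    intro G W C hG hxy hV
    refine ⟨G, ?_, ?_⟩
    · ext e
      have := mop_sub hG hxy
      simp
      rintro rfl
      exact this
    · convert hG using 1
      · have := mop_cyc hG hxy
        ext e; simp; grind
      · ext e; simp; grind
  | node x y z E₁ E₂ V₁ V₂ P₁ P₂ h₁ h₂ hV ih₁ ih₂ =>
    intro G W C hG hxy hVW
    have b1 := h₁.basic
    have b2 := h₂.basic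
    have hm := mop_cyc hG hxy
    have hyV1 : y ∉ V₁ := fun h => b2.1 (hV y h b2.2.2.1).symm
    have hxV2 : x ∉ V₂ := fun h => b1.1 (hV x b1.2.1 h)
    have hz : z ∉ W := by
      intro h
      have := hVW z (Finset.mem_union_left _ b1.2.2.1) h
      grind
    have g0 := IsMopCycle.grow G W C x y z hG hxy hz
    obtain ⟨G1, e1, g1⟩ := ih₁ _ _ _ g0 (by simp) (by
      intro a; simp only [Finset.mem_insert]; grind)
    obtain ⟨G2, e2, g2⟩ := ih₂ _ _ _ g1 (by
        apply Finset.mem_union_left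
        simp only [Finset.mem_insert, Finset.mem_erase, Sym2.eq_iff, ne_eq]
        grind) (by
      intro a; simp only [Finset.mem_insert, Finset.mem_union]; grind)
    refine ⟨G2, ?_, ?_⟩
    · rw [e2, e1, edgeSet_from]
      · have p1 := b1.2.2.2.1
        have p2 := b2.2.2.2.1
        have p3 := mop_sub hG hxy
        rw [Sym2.eq_swap] at p2
        ext e
        simp only [Set.mem_insert_iff, Set.mem_union, Finset.coe_insert, Finset.coe_union,
          Finset.mem_coe]
        grind
      · intro p q h
        simp only [Set.mem_insert_iff, Sym2.eq_iff] at h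
        have := fun h => mop_edge hG (a := p) (b := q) h
        grind
    · convert g2 using 1
      · ext a; simp only [Finset.mem_insert, Finset.mem_union]; grind
      · have q1 : s(x, z) ∉ C := fun h => hz (mop_cyc hG h).2.1
        have q2 : s(z, y) ∉ C := fun h => hz (mop_cyc hG h).1
        have q3 : s(z, y) ∉ P₁ := fun h => hyV1 (h₁.edgeP h).2.1
        have q4 : s(y, z) = s(z, y) := Sym2.eq_swap
        ext e; simp only [Finset.mem_insert, Finset.mem_union, Finset.mem_erase, q4]; grind

theorem piece_mop {x y E V P} (h : Piece x y E V P) (hP : 2 ≤ P.card) :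
    ∃ G', G'.edgeSet = (E : Set (Sym2 ℕ)) ∧ IsMopCycle G' V (insert s(x, y) P) := by
  induction h with
  | leaf x y h => simp at hP
  | node x y z E₁ E₂ V₁ V₂ P₁ P₂ h₁ h₂ hV _ _ =>
    have b1 := h₁.basic
    have b2 := h₂.basic
    have hyV1 : y ∉ V₁ := fun h => b2.1 (hV y h b2.2.2.1).symm
    have hxV2 : x ∉ V₂ := fun h => b1.1 (hV x b1.2.1 h)
    have hxy : x ≠ y := fun h => hxV2 (h ▸ b2.2.2.1)
    have g0 := IsMopCycle.triangle x z y b1.1 hxy b2.1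
    obtain ⟨G1, e1, g1⟩ := glue h₁ _ _ _ g0 (by simp) (by
      intro a; simp only [Finset.mem_insert, Finset.mem_singleton]; grind)
    obtain ⟨G2, e2, g2⟩ := glue h₂ _ _ _ g1 (by
        apply Finset.mem_union_left
        simp only [Finset.mem_insert, Finset.mem_erase, Sym2.eq_iff, ne_eq, Finset.mem_singleton]
        grind) (by
      intro a; simp only [Finset.mem_insert, Finset.mem_union, Finset.mem_singleton]; grind)
    refine ⟨G2, ?_, ?_⟩
    · rw [e2, e1, edgeSet_from]
      · have p1 := b1.2.2.2.1
        have p2 := b2.2.2.2.1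
        ext e
        simp only [Set.mem_insert_iff, Set.mem_union, Finset.coe_insert, Finset.coe_union,
          Finset.mem_coe, Set.mem_singleton_iff]
        grind
      · intro p q h
        simp only [Set.mem_insert_iff, Sym2.eq_iff, Set.mem_singleton_iff] at h
        grind
    · convert g2 using 1
      · ext a; simp only [Finset.mem_insert, Finset.mem_union, Finset.mem_singleton]; grind
      · have q3 : s(z, y) ∉ P₁ := fun h => hyV1 (h₁.edgeP h).2.1
        have q4 : s(x, y) ≠ s(x, z) := by simp only [ne_eq, Sym2.eq_iff]; grind
        have q5 : s(x, y) ≠ s(z, y) := by simp only [ne_eq, Sym2.eq_iff]; grind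
        ext e
        simp only [Finset.mem_insert, Finset.mem_union, Finset.mem_erase, Finset.mem_singleton]
        grind

/-- The mop `H` (on `W`, cycle `D`) and the piece `E, V, P` at `xy` together make up `S, U, C`. -/
structure Split (S : Set (Sym2 ℕ)) (U : Finset ℕ) (C : Finset (Sym2 ℕ)) (x y : ℕ)
    (E : Finset (Sym2 ℕ)) (V : Finset ℕ) (P : Finset (Sym2 ℕ)) : Prop where
  piece : Piece x y E V P
  ex : ∃ H W D, IsMopCycle H W D ∧ s(x, y) ∈ D ∧ (∀ a, a ∈ V → a ∈ W → a = x ∨ a = y) ∧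
    S = H.edgeSet ∪ E ∧ U = W ∪ V ∧ C = D.erase s(x, y) ∪ P

theorem Split.swap {S U C x y E V P} (h : Split S U C x y E V P) : Split S U C y x E V P := by
  obtain ⟨hp, H, W, D, h1, h2, h3, h4, h5, h6⟩ := h
  refine ⟨hp.swap, H, W, D, h1, ?_, fun a p q => (h3 a p q).symm, h4, h5, ?_⟩
  · rwa [Sym2.eq_swap]
  · rwa [Sym2.eq_swap]

theorem Split.left {S U C x y z E₁ V₁ P₁ E₂ V₂ P₂}
    (h₁ : Piece x z E₁ V₁ P₁) (h₂ : Piece z y E₂ V₂ P₂)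
    (hV : ∀ a, a ∈ V₁ → a ∈ V₂ → a = z)
    (h : Split S U C x y (insert s(x, y) (E₁ ∪ E₂)) (V₁ ∪ V₂) (P₁ ∪ P₂)) :
    Split S U C x z E₁ V₁ P₁ := by
  obtain ⟨hp, G, W, D, hG, hxy, hVW, h4, h5, h6⟩ := h
  refine ⟨h₁, ?_⟩
  have b1 := h₁.basic
  have b2 := h₂.basic
  have hm := mop_cyc hG hxy
  have hyV1 : y ∉ V₁ := fun h => b2.1 (hV y h b2.2.2.1).symm
  have hxV2 : x ∉ V₂ := fun h => b1.1 (hV x b1.2.1 h)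
  have hz : z ∉ W := by
    intro h
    have := hVW z (Finset.mem_union_left _ b1.2.2.1) h
    grind
  have g0 := IsMopCycle.grow G W D x y z hG hxy hz
  obtain ⟨G2, e2, g2⟩ := glue h₂ _ _ _ g0 (by simp [Sym2.eq_swap]) (by
      intro a; simp only [Finset.mem_insert]; grind)
  have q0 : s(x, z) ≠ s(z, y) := by simp only [ne_eq, Sym2.eq_iff]; grind
  refine ⟨G2, _, _, g2, ?_, ?_, ?_, ?_, ?_⟩
  · simp only [Finset.mem_insert, Finset.mem_erase, Finset.mem_union]
    grind
  · intro a; simp only [Finset.mem_insert, Finset.mem_union]; grind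
  · rw [h4, e2, edgeSet_from]
    · have p1 := b1.2.2.2.1
      have p2 := b2.2.2.2.1
      have p3 := mop_sub hG hxy
      rw [Sym2.eq_swap] at p2
      ext e
      simp only [Set.mem_insert_iff, Set.mem_union, Finset.coe_insert, Finset.coe_union,
        Finset.mem_coe]
      grind
    · intro p q h
      simp only [Set.mem_insert_iff, Sym2.eq_iff] at h
      have := fun h => mop_edge hG (a := p) (b := q) h
      grind
  · rw [h5]; ext a; simp only [Finset.mem_insert, Finset.mem_union]; grind
  · have q1 : s(x, z) ∉ D := fun h => hz (mop_cyc hG h).2.1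
    have q2 : s(z, y) ∉ D := fun h => hz (mop_cyc hG h).1
    have q3 : s(x, z) ∉ P₂ := fun h => hxV2 (h₂.edgeP h).1
    have q4 : s(y, z) = s(z, y) := Sym2.eq_swap
    rw [h6]
    ext e; simp only [Finset.mem_insert, Finset.mem_union, Finset.mem_erase, q4]; grind

theorem Split.right {S U C x y z E₁ V₁ P₁ E₂ V₂ P₂}
    (h₁ : Piece x z E₁ V₁ P₁) (h₂ : Piece z y E₂ V₂ P₂)
    (hV : ∀ a, a ∈ V₁ → a ∈ V₂ → a = z)
    (h : Split S U C x y (insert s(x, y) (E₁ ∪ E₂)) (V₁ ∪ V₂) (P₁ ∪ P₂)) :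
    Split S U C z y E₂ V₂ P₂ := by
  refine (Split.left h₂.swap h₁.swap (fun a p q => hV a q p) ?_).swap
  have := h.swap
  rwa [Sym2.eq_swap, Finset.union_comm E₁, Finset.union_comm V₁, Finset.union_comm P₁] at this

theorem descend {S U C x y E V P} (h : Piece x y E V P) (hs : Split S U C x y E V P)
    (hP : 4 ≤ P.card) : ∃ x y E V P, Split S U C x y E V P ∧ 4 ≤ P.card ∧ P.card ≤ 6 := by
  induction h with
  | leaf x y h => simp at hP
  | node x y z E₁ E₂ V₁ V₂ P₁ P₂ h₁ h₂ hV ih₁ ih₂ =>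
    by_cases h6 : (P₁ ∪ P₂).card ≤ 6
    · exact ⟨_, _, _, _, _, hs, hP, h6⟩
    · have := Finset.card_union_le P₁ P₂
      by_cases h4 : 4 ≤ P₁.card
      · exact ih₁ (hs.left h₁ h₂ hV) h4
      · exact ih₂ (hs.right h₁ h₂ hV) (by omega)

theorem start_left {x y z E₁ V₁ P₁ E₂ V₂ P₂}
    (h₁ : Piece x z E₁ V₁ P₁) (h₂ : Piece z y E₂ V₂ P₂)
    (hV : ∀ a, a ∈ V₁ → a ∈ V₂ → a = z) :
    Split ((insert s(x, y) (E₁ ∪ E₂) : Finset (Sym2 ℕ)) : Set (Sym2 ℕ)) (V₁ ∪ V₂)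
      (insert s(x, y) (P₁ ∪ P₂)) x z E₁ V₁ P₁ := by
  have b1 := h₁.basic
  have b2 := h₂.basic
  have hyV1 : y ∉ V₁ := fun h => b2.1 (hV y h b2.2.2.1).symm
  have hxV2 : x ∉ V₂ := fun h => b1.1 (hV x b1.2.1 h)
  have hxy : x ≠ y := fun h => hxV2 (h ▸ b2.2.2.1)
  have g0 := IsMopCycle.triangle x z y b1.1 hxy b2.1
  obtain ⟨G2, e2, g2⟩ := glue h₂ _ _ _ g0 (by simp) (by
      intro a; simp only [Finset.mem_insert, Finset.mem_singleton]; grind)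
  have q0 : s(x, z) ≠ s(z, y) := by simp only [ne_eq, Sym2.eq_iff]; grind
  have q3 : s(x, z) ∉ P₂ := fun h => hxV2 (h₂.edgeP h).1
  have q4 : s(x, y) ≠ s(x, z) := by simp only [ne_eq, Sym2.eq_iff]; grind
  have q5 : s(x, y) ≠ s(z, y) := by simp only [ne_eq, Sym2.eq_iff]; grind
  refine ⟨h₁, G2, _, _, g2, ?_, ?_, ?_, ?_, ?_⟩
  · simp only [Finset.mem_insert, Finset.mem_erase, Finset.mem_union]
    grind
  · intro a; simp only [Finset.mem_insert, Finset.mem_union, Finset.mem_singleton]; grind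
  · rw [e2, edgeSet_from]
    · have p1 := b1.2.2.2.1
      have p2 := b2.2.2.2.1
      ext e
      simp only [Set.mem_insert_iff, Set.mem_union, Finset.coe_insert, Finset.coe_union,
        Finset.mem_coe, Set.mem_singleton_iff]
      grind
    · intro p q h
      simp only [Set.mem_insert_iff, Sym2.eq_iff, Set.mem_singleton_iff] at h
      grind
  · ext a; simp only [Finset.mem_insert, Finset.mem_union, Finset.mem_singleton]; grind
  · ext e
    simp only [Finset.mem_insert, Finset.mem_union, Finset.mem_erase, Finset.mem_singleton]
    grind

theorem exists_split {x y E V P} (h : Piece x y E V P) (hP : 7 ≤ P.card) :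
    ∃ a b E' V' P', Split (E : Set (Sym2 ℕ)) V (insert s(x, y) P) a b E' V' P' ∧
      4 ≤ P'.card ∧ P'.card ≤ 6 := by
  induction h with
  | leaf x y h => simp at hP
  | node x y z E₁ E₂ V₁ V₂ P₁ P₂ h₁ h₂ hV _ _ =>
    have := Finset.card_union_le P₁ P₂
    by_cases h4 : 4 ≤ P₁.card
    · exact descend h₁ (start_left h₁ h₂ hV) h4
    · refine descend h₂.swap (x := y) (y := z) ?_ (by omega)
      have := start_left h₂.swap h₁.swap (fun a p q => hV a q p)
      rwa [Sym2.eq_swap, Finset.union_comm E₂, Finset.union_comm V₂,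
        Finset.union_comm P₂] at this

/-- **Lemma 5 (Chvátal).** A mop of order `n ≥ 8` has a diagonal `d = xy` which
partitions it into two mops `G₁` and `G₂` such that `G₁` contains exactly `4`, `5`
or `6` Hamiltonian edges of `G`. -/
theorem mop_exists_diagonal_partition_four_five_six (G : SimpleGraph ℕ) (V : Finset ℕ)
    (C : Finset (Sym2 ℕ)) (h : IsMopCycle G V C) (hn : 8 ≤ V.card) :
    ∃ (x y : ℕ) (G₁ G₂ : SimpleGraph ℕ) (V₁ V₂ : Finset ℕ),
      G.Adj x y ∧ s(x, y) ∉ C ∧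
      IsMop G₁ V₁ ∧ IsMop G₂ V₂ ∧ G = G₁ ⊔ G₂ ∧ V = V₁ ∪ V₂ ∧
      V₁ ∩ V₂ = ({x, y} : Finset ℕ) ∧
      G₁.edgeSet ∩ G₂.edgeSet = {s(x, y)} ∧
      ((C : Set (Sym2 ℕ)) ∩ G₁.edgeSet).ncard ∈ ({4, 5, 6} : Set ℕ) := by
  obtain ⟨x, y, E, P, hp, hE, hC, -⟩ := mop_piece h
  have hc := hp.card
  obtain ⟨a, b, E', V', P', hs, h4, h6⟩ := exists_split hp (by omega)
  obtain ⟨hp', H, W, D, hH, hab, hVW, hS, hU, hCD⟩ := hs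
  obtain ⟨G₁, hG₁, hm⟩ := piece_mop hp' (by omega)
  rw [← hE] at hS
  rw [← hC] at hCD
  have hb := hp'.basic
  have hmc := mop_cyc hH hab
  have hroot := hp'.root_notMem (by omega)
  have hint : G₁.edgeSet ∩ H.edgeSet = {s(a, b)} := by
    ext e
    induction e with | _ p q
    rw [hG₁]
    simp only [Set.mem_inter_iff, Finset.mem_coe, Set.mem_singleton_iff]
    constructor
    · rintro ⟨h1, h2⟩
      have := hp'.edge h1
      have := mop_edge hH h2
      rw [Sym2.eq_iff]
      grind
    · intro h
      rw [h]
      exact ⟨hb.2.2.2.1, mop_sub hH hab⟩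
  refine ⟨a, b, G₁, H, V', W, ?_, ?_, ⟨_, hm⟩, ⟨_, hH⟩, ?_, ?_, ?_, hint, ?_⟩
  · rw [← mem_edgeSet, hS]
    exact Or.inr hb.2.2.2.1
  · rw [hCD]
    simp [hroot]
  · rw [← edgeSet_inj, edgeSet_sup, hS, hG₁, Set.union_comm]
  · rw [hU, Finset.union_comm]
  · ext e; simp only [Finset.mem_inter, Finset.mem_insert, Finset.mem_singleton]; grind
  · have : (C : Set (Sym2 ℕ)) ∩ G₁.edgeSet = (P' : Set (Sym2 ℕ)) := by
      ext e
      have h1 : e ∈ G₁.edgeSet → e ∈ H.edgeSet → e = s(a, b) := by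
        intro p q
        have : e ∈ G₁.edgeSet ∩ H.edgeSet := ⟨p, q⟩
        rwa [hint] at this
      have h2 : e ∈ D → e ∈ H.edgeSet := fun h => mop_sub hH h
      have h3 : e ∈ P' → e ∈ G₁.edgeSet := fun h => by rw [hG₁]; exact hb.2.2.2.2.1 h
      rw [hCD]
      simp only [Set.mem_inter_iff, Finset.mem_coe, Finset.mem_union, Finset.mem_erase]
      tauto
    rw [this, Set.ncard_coe_finset]
    simp only [Set.mem_insert_iff, Set.mem_singleton_iff]
    omega
end
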